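/- arXiv:1504.06238 — 2 statements merged into one kernel-verified Lean document; each statement's English description precedes it below -/
import Mathlib

section
/- Fix an integer k ≥ 2. In the random k-out digraph 𝒟_{n,k}, let W_n = max over vertices v outside the giant 𝒢 of the minimum over u ∈ 𝒢 of dist(v,u), where dist(v,u) is the length of the shortest directed path from v to u (∞ if u is not reachable from v). Then W_n / log_k log n converges in probability to 1: for every ε > 0, P(|W_n/log_k log n − 1| > ε) → 0 as n → ∞. -/
open scoped Classical
open Filter MeasureTheory

/-- Probability of an event under the uniform random `k`-out digraph model `𝒟_{n,k}`:
a uniformly random function `f : [n] × [k] → [n]`. -/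
noncomputable def prob (n k : ℕ) (P : (Fin n × Fin k → Fin n) → Prop) : ℝ :=
  ((Finset.univ.filter P).card : ℝ) / (Fintype.card (Fin n × Fin k → Fin n) : ℝ)

/-- One arc step: there is a labeled arc from `u` to `v`. -/
def Step {n k : ℕ} (f : Fin n × Fin k → Fin n) (u v : Fin n) : Prop :=
  ∃ i : Fin k, f (u, i) = v

/-- `u` reaches `v` by following finitely many arcs. -/
def Reaches {n k : ℕ} (f : Fin n × Fin k → Fin n) : Fin n → Fin n → Prop :=
  Relation.ReflTransGen (Step f)

/-- A set of vertices is closed if no arc leaves it. -/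
def IsClosedSet {n k : ℕ} (f : Fin n × Fin k → Fin n) (S : Set (Fin n)) : Prop :=
  ∀ v ∈ S, ∀ i : Fin k, f (v, i) ∈ S

/-- A set of vertices is strongly connected if it is nonempty and
any two of its vertices reach each other. -/
def IsStrConn {n k : ℕ} (f : Fin n × Fin k → Fin n) (S : Set (Fin n)) : Prop :=
  S.Nonempty ∧ ∀ u ∈ S, ∀ v ∈ S, Reaches f u v

/-- `G` is the giant: a closed strongly connected set of maximum size,
ties broken by choosing the one containing the smallest vertex label. -/
def IsGiant {n k : ℕ} (f : Fin n × Fin k → Fin n) (G : Set (Fin n)) : Prop :=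
  IsClosedSet f G ∧ IsStrConn f G ∧
    (∀ S : Set (Fin n), IsClosedSet f S → IsStrConn f S → S.ncard ≤ G.ncard) ∧
    (∀ S : Set (Fin n), IsClosedSet f S → IsStrConn f S → S.ncard = G.ncard →
      ∃ v ∈ G, ∀ u ∈ S, v ≤ u)

/-- `pathDist f u v`: the length of the shortest directed path from `u` to `v`
(`⊤` if `v` is not reachable from `u`). -/
noncomputable def pathDist {n k : ℕ} (f : Fin n × Fin k → Fin n) (u v : Fin n) : ℕ∞ :=
  sInf {ℓ : ℕ∞ | ∃ m : ℕ, ℓ = (m : ℕ∞) ∧ ∃ c : Fin (m + 1) → Fin n,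
    c 0 = u ∧ c (Fin.last m) = v ∧ ∀ j : Fin m, ∃ i : Fin k, f (c j.castSucc, i) = c j.succ}

/-! ### Resampling coordinates -/

/-- If, on an event `E`, the coordinates in a random set `A f` may be resampled without changing
`A f`, the target set `T f` or `E`, then the probability that they all land in `T f` is at most
the supremum of `(|T f| / |β|) ^ |A f|`. -/
lemma card_filter_resample_le {ι β : Type*} [Fintype ι] [Fintype β] [Nonempty β]
    (A : (ι → β) → Finset ι) (E : (ι → β) → Prop) (T : (ι → β) → Finset β)
    (hA : ∀ f g, E f → (∀ i, i ∉ A f → g i = f i) → A g = A f)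
    (hE : ∀ f g, E f → (∀ i, i ∉ A f → g i = f i) → E g)
    (hT : ∀ f g, E f → (∀ i, i ∉ A f → g i = f i) → T g = T f)
    (p : ℝ) (hp : ∀ f, E f → (((T f).card : ℝ) / Fintype.card β) ^ (A f).card ≤ p) :
    ((Finset.univ.filter (fun f => E f ∧ ∀ i ∈ A f, f i ∈ T f)).card : ℝ)
      ≤ p * (Finset.univ.filter E).card := by
  have hβ : (0 : ℝ) < Fintype.card β := by exact_mod_cast Fintype.card_pos
  have fiber : ∀ (f : ι → β) (U : Finset β),
      (Finset.univ.filter (fun g : ι → β => (∀ i, i ∉ A f → g i = f i) ∧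
        ∀ i ∈ A f, g i ∈ U)).card = U.card ^ (A f).card := by
    intro f U
    have : Finset.univ.filter (fun g : ι → β => (∀ i, i ∉ A f → g i = f i) ∧
        ∀ i ∈ A f, g i ∈ U) = Fintype.piFinset (fun i => if i ∈ A f then U else {f i}) := by
      ext g
      simp only [Finset.mem_filter, Finset.mem_univ, true_and, Fintype.mem_piFinset]
      constructor
      · rintro ⟨h1, h2⟩ i
        by_cases hi : i ∈ A f
        · simpa [hi] using h2 i hi
        · simpa [hi] using h1 i hi
      · intro h
        refine ⟨fun i hi => by simpa [hi] using h i, fun i hi => by simpa [hi] using h i⟩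
    rw [this, Fintype.card_piFinset]
    simp only [apply_ite Finset.card, Finset.card_singleton]
    rw [Finset.prod_ite]
    simp
  have total : ∀ f : ι → β, (Finset.univ.filter (fun g : ι → β =>
      (∀ i, i ∉ A f → g i = f i))).card = Fintype.card β ^ (A f).card := by
    intro f
    simpa using fiber f Finset.univ
  calc ((Finset.univ.filter (fun f => E f ∧ ∀ i ∈ A f, f i ∈ T f)).card : ℝ)
      = ∑ g ∈ Finset.univ.filter (fun f => E f ∧ ∀ i ∈ A f, f i ∈ T f),
          ∑ f ∈ Finset.univ.filter (fun f : ι → β => ∀ i, i ∉ A g → f i = g i),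
            ((Fintype.card β : ℝ) ^ (A g).card)⁻¹ := by
        rw [Finset.card_eq_sum_ones, Nat.cast_sum]
        refine Finset.sum_congr rfl fun g _ => ?_
        rw [Finset.sum_const, total, nsmul_eq_mul]
        push_cast
        rw [mul_inv_cancel₀ (by positivity)]
    _ = ∑ f ∈ Finset.univ.filter E,
          ∑ g ∈ Finset.univ.filter (fun g : ι → β => (∀ i, i ∉ A f → g i = f i) ∧
            ∀ i ∈ A f, g i ∈ T f), ((Fintype.card β : ℝ) ^ (A f).card)⁻¹ := by
        rw [Finset.sum_sigma', Finset.sum_sigma']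
        refine Finset.sum_bij' (fun x _ => ⟨x.2, x.1⟩) (fun x _ => ⟨x.2, x.1⟩) ?_ ?_ ?_ ?_ ?_
        · rintro ⟨g, f⟩ h
          simp only [Finset.mem_sigma, Finset.mem_filter, Finset.mem_univ, true_and] at h ⊢
          obtain ⟨⟨h1, h2⟩, h3⟩ := h
          rw [hA g f h1 h3, hT g f h1 h3]
          exact ⟨hE g f h1 h3, fun i hi => (h3 i hi).symm, h2⟩
        · rintro ⟨f, g⟩ h
          simp only [Finset.mem_sigma, Finset.mem_filter, Finset.mem_univ, true_and] at h ⊢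
          obtain ⟨h1, h3, h2⟩ := h
          rw [hA f g h1 h3, hT f g h1 h3]
          exact ⟨⟨hE f g h1 h3, h2⟩, fun i hi => (h3 i hi).symm⟩
        · intros; rfl
        · intros; rfl
        · rintro ⟨g, f⟩ h
          simp only [Finset.mem_sigma, Finset.mem_filter, Finset.mem_univ, true_and] at h ⊢
          rw [hA g f h.1.1 h.2]
    _ ≤ ∑ f ∈ Finset.univ.filter E, p := by
        refine Finset.sum_le_sum fun f hf => ?_
        rw [Finset.sum_const, fiber, nsmul_eq_mul]
        refine le_trans (le_of_eq ?_) (hp f (by simpa using hf))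
        push_cast
        rw [div_pow, div_eq_mul_inv]
    _ = p * (Finset.univ.filter E).card := by
        rw [Finset.sum_const, nsmul_eq_mul, mul_comm]

/-! ### Basic properties of `prob` -/

lemma prob_eq {n k : ℕ} (P : (Fin n × Fin k → Fin n) → Prop) [DecidablePred P] :
    prob n k P = ((Finset.univ.filter P).card : ℝ) / (Fintype.card (Fin n × Fin k → Fin n) : ℝ) := by
  unfold prob
  congr!

lemma prob_nonneg {n k : ℕ} (P : (Fin n × Fin k → Fin n) → Prop) : 0 ≤ prob n k P := by
  unfold prob; positivity

lemma prob_mono {n k : ℕ} {P Q : (Fin n × Fin k → Fin n) → Prop} (h : ∀ f, P f → Q f) :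
    prob n k P ≤ prob n k Q := by
  unfold prob
  gcongr
  exact h _

lemma prob_le_one {n k : ℕ} (P : (Fin n × Fin k → Fin n) → Prop) : prob n k P ≤ 1 := by
  unfold prob
  refine div_le_one_of_le₀ ?_ (by positivity)
  exact_mod_cast Finset.card_filter_le _ _

lemma prob_or_le {n k : ℕ} (P Q : (Fin n × Fin k → Fin n) → Prop) :
    prob n k (fun f => P f ∨ Q f) ≤ prob n k P + prob n k Q := by
  rw [prob_eq, prob_eq P, prob_eq Q, ← add_div]
  gcongr
  rw [Finset.filter_or]
  exact_mod_cast Finset.card_union_le _ _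

lemma prob_exists_le {n k : ℕ} {ι : Type*} (I : Finset ι)
    (P : ι → (Fin n × Fin k → Fin n) → Prop) :
    prob n k (fun f => ∃ a ∈ I, P a f) ≤ ∑ a ∈ I, prob n k (P a) := by
  rw [prob_eq]
  unfold prob
  rw [← Finset.sum_div]
  gcongr
  have : Finset.univ.filter (fun f => ∃ a ∈ I, P a f)
      = I.biUnion (fun a => Finset.univ.filter (P a)) := by
    ext f; simp
  rw [this]
  exact_mod_cast Finset.card_biUnion_le

lemma sum_prob_eq {n k : ℕ} {ι : Type*} (I : Finset ι)
    (P : ι → (Fin n × Fin k → Fin n) → Prop) :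
    ∑ a ∈ I, prob n k (P a)
      = (∑ f, ((I.filter fun a => P a f).card : ℝ)) / Fintype.card (Fin n × Fin k → Fin n) := by
  unfold prob
  rw [← Finset.sum_div]
  congr 1
  simp only [Finset.card_filter, Nat.cast_sum]
  rw [Finset.sum_comm]

lemma prob_resample_le {n k : ℕ} [NeZero n]
    (A : (Fin n × Fin k → Fin n) → Finset (Fin n × Fin k))
    (E : (Fin n × Fin k → Fin n) → Prop) (T : (Fin n × Fin k → Fin n) → Finset (Fin n))
    (hA : ∀ f g, E f → (∀ i, i ∉ A f → g i = f i) → A g = A f)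
    (hE : ∀ f g, E f → (∀ i, i ∉ A f → g i = f i) → E g)
    (hT : ∀ f g, E f → (∀ i, i ∉ A f → g i = f i) → T g = T f)
    (p : ℝ) (hp : ∀ f, E f → (((T f).card : ℝ) / n) ^ (A f).card ≤ p) :
    prob n k (fun f => E f ∧ ∀ e ∈ A f, f e ∈ T f) ≤ p * prob n k E := by
  rw [prob_eq, prob_eq E, ← mul_div_assoc]
  gcongr
  refine le_trans (le_of_eq ?_)
    ((card_filter_resample_le A E T hA hE hT p (by simpa using hp)).trans (le_of_eq ?_)) <;> congr!

/-! ### Small closed sets -/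

lemma prob_isClosedSet_le {n k : ℕ} [NeZero n] (S : Finset (Fin n)) :
    prob n k (fun f => IsClosedSet f (S : Set (Fin n)))
      ≤ ((S.card : ℝ) / n) ^ (S.card * k) := by
  have h := prob_resample_le (n := n) (k := k) (fun _ => S ×ˢ Finset.univ) (fun _ => True)
    (fun _ => S) (fun _ _ _ _ => rfl) (fun _ _ _ _ => trivial) (fun _ _ _ _ => rfl)
    (((S.card : ℝ) / n) ^ (S.card * k)) (by simp)
  refine le_trans (prob_mono fun f hf => ?_)
    (h.trans (mul_le_of_le_one_right (by positivity) (prob_le_one _)))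
  refine ⟨trivial, fun e he => ?_⟩
  have := hf e.1 (by simpa using he) e.2
  simpa using this

lemma choose_mul_pow_le {n k s : ℕ} (hk : 2 ≤ k) (hn : 0 < n) (hs : 1 ≤ s) (hsn : 12 * s ≤ n) :
    (n.choose s : ℝ) * ((s : ℝ) / n) ^ (s * k) ≤ 3 / n * (1 / 2) ^ (s - 1) := by
  have hn' : (0 : ℝ) < n := by exact_mod_cast hn
  have hs' : (0 : ℝ) < s := by exact_mod_cast hs
  have hsn' : 12 * (s : ℝ) ≤ n := by exact_mod_cast hsn
  have h1 : (s : ℝ) / n ≤ 1 / 12 := by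
    rw [div_le_iff₀ hn']; linarith
  have h2 : ((s : ℝ) / n) ^ (s * k) ≤ ((s : ℝ) / n) ^ s * ((s : ℝ) / n) ^ s := by
    rw [← pow_add]
    exact pow_le_pow_of_le_one (by positivity) (by linarith) (by nlinarith)
  have h3 : (n.choose s : ℝ) ≤ (n : ℝ) ^ s / s.factorial := Nat.choose_le_pow_div s n
  have h4 : (s : ℝ) ^ s / s.factorial ≤ Real.exp s :=
    Real.pow_div_factorial_le_exp (s : ℝ) hs'.le s
  have h5 : Real.exp s ≤ 3 ^ s := by
    rw [← mul_one (s : ℝ), Real.exp_nat_mul]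
    gcongr
    exact Real.exp_one_lt_three.le
  obtain ⟨m, rfl⟩ : ∃ m, s = m + 1 := ⟨s - 1, by omega⟩
  calc (n.choose (m + 1) : ℝ) * (((m + 1 : ℕ) : ℝ) / n) ^ ((m + 1) * k)
      ≤ (n : ℝ) ^ (m + 1) / (m + 1).factorial *
        ((((m + 1 : ℕ) : ℝ) / n) ^ (m + 1) * (((m + 1 : ℕ) : ℝ) / n) ^ (m + 1)) := by gcongr
    _ = ((m + 1 : ℕ) : ℝ) ^ (m + 1) / (m + 1).factorial *
        (((m + 1 : ℕ) : ℝ) / n) ^ (m + 1) := by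
        rw [div_mul_eq_mul_div, div_mul_eq_mul_div, ← mul_assoc, ← mul_pow,
          mul_div_cancel₀ _ hn'.ne']
    _ ≤ 3 ^ (m + 1) * (((m + 1 : ℕ) : ℝ) / n) ^ (m + 1) := by
        gcongr; exact h4.trans h5
    _ = 3 / n * ((m + 1 : ℕ) : ℝ) * (3 * (((m + 1 : ℕ) : ℝ) / n)) ^ m := by
        rw [mul_pow, pow_succ, pow_succ]; ring
    _ ≤ 3 / n * (2 : ℝ) ^ m * (1 / 4) ^ m := by
        gcongr
        · exact_mod_cast Nat.lt_two_pow_self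
        · linarith
    _ = 3 / n * (1 / 2) ^ (m + 1 - 1) := by
        rw [mul_assoc, ← mul_pow]; norm_num

lemma prob_exists_small_isClosedSet_le {n k : ℕ} (hk : 2 ≤ k) [NeZero n] :
    prob n k (fun f => ∃ S : Finset (Fin n), S.Nonempty ∧ 12 * S.card ≤ n ∧
      IsClosedSet f (S : Set (Fin n))) ≤ 6 / n := by
  have hn : 0 < n := NeZero.pos n
  set J := (Finset.range (n + 1)).filter (fun s => 1 ≤ s ∧ 12 * s ≤ n) with hJ
  have h1 := prob_exists_le (n := n) (k := k)
    (Finset.univ.filter fun S : Finset (Fin n) => S.card ∈ J)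
    (fun S f => IsClosedSet f (S : Set (Fin n)))
  refine le_trans (prob_mono ?_) (h1.trans ?_)
  · rintro f ⟨S, hS, hc, hcl⟩
    have : S.card ≤ n := by simpa using S.card_le_univ
    exact ⟨S, by simp [hJ, hc]; exact ⟨by omega, hS⟩, hcl⟩
  calc ∑ S ∈ Finset.univ.filter (fun S : Finset (Fin n) => S.card ∈ J),
        prob n k (fun f => IsClosedSet f (S : Set (Fin n)))
      ≤ ∑ S ∈ Finset.univ.filter (fun S : Finset (Fin n) => S.card ∈ J),
        ((S.card : ℝ) / n) ^ (S.card * k) := Finset.sum_le_sum fun S _ => prob_isClosedSet_le S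
    _ = ∑ s ∈ J, ∑ S ∈ Finset.univ.filter (fun S : Finset (Fin n) => S.card ∈ J) with
          S.card = s, ((S.card : ℝ) / n) ^ (S.card * k) := by
        rw [Finset.sum_fiberwise_of_maps_to]
        intro S hS; simpa using hS
    _ = ∑ s ∈ J, (n.choose s : ℝ) * ((s : ℝ) / n) ^ (s * k) := by
        refine Finset.sum_congr rfl fun s hs => ?_
        have : ((Finset.univ.filter fun S : Finset (Fin n) => S.card ∈ J).filter
            fun S => S.card = s) = Finset.powersetCard s Finset.univ := by
          ext S
          simp only [Finset.mem_filter, Finset.mem_univ, true_and, Finset.mem_powersetCard,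
            Finset.subset_univ]
          exact ⟨fun h => h.2, fun h => ⟨h ▸ hs, h⟩⟩
        rw [this, Finset.sum_congr rfl (g := fun _ => ((s : ℝ) / n) ^ (s * k))]
        · simp
        · intro S hS
          rw [(Finset.mem_powersetCard.1 hS).2]
    _ ≤ ∑ s ∈ J, 3 / n * (1 / 2 : ℝ) ^ (s - 1) := by
        refine Finset.sum_le_sum fun s hs => ?_
        simp only [hJ, Finset.mem_filter] at hs
        exact choose_mul_pow_le hk hn hs.2.1 hs.2.2
    _ ≤ ∑ s ∈ Finset.Ico 1 (n + 1), 3 / n * (1 / 2 : ℝ) ^ (s - 1) := by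
        refine Finset.sum_le_sum_of_subset_of_nonneg ?_ (fun _ _ _ => by positivity)
        intro s hs
        simp only [hJ, Finset.mem_filter, Finset.mem_range, Finset.mem_Ico] at hs ⊢
        omega
    _ = 3 / n * ∑ s ∈ Finset.range n, (1 / 2 : ℝ) ^ s := by
        rw [Finset.sum_Ico_eq_sum_range, Finset.mul_sum]
        simp
    _ ≤ 3 / n * 2 := by
        gcongr
        exact sum_geometric_two_le n
    _ = 6 / n := by ring

/-! ### Out-balls -/

/-- The set of vertices reachable from `v` in at most `j` steps without using the arcs in `T`. -/
noncomputable def arcBall {n k : ℕ} (f : Fin n × Fin k → Fin n) (T : Finset (Fin n × Fin k))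
    (v : Fin n) : ℕ → Finset (Fin n)
  | 0 => {v}
  | j + 1 => arcBall f T v j ∪ ((arcBall f T v j ×ˢ Finset.univ) \ T).image f

section ArcBall

variable {n k : ℕ} {f g : Fin n × Fin k → Fin n} {T : Finset (Fin n × Fin k)} {v w : Fin n}

lemma mem_arcBall_succ {j : ℕ} : w ∈ arcBall f T v (j + 1) ↔
    w ∈ arcBall f T v j ∨ ∃ e : Fin n × Fin k, e.1 ∈ arcBall f T v j ∧ e ∉ T ∧ f e = w := by
  simp [arcBall, and_assoc]

lemma arcBall_mono : Monotone (arcBall f T v) :=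
  monotone_nat_of_le_succ fun j => by
    rw [arcBall]; exact Finset.subset_union_left

lemma self_mem_arcBall (j : ℕ) : v ∈ arcBall f T v j :=
  arcBall_mono (Nat.zero_le j) (by simp [arcBall])

lemma arcBall_subset (j : ℕ) : arcBall f T v j ⊆ arcBall f ∅ v j := by
  induction j with
  | zero => simp [arcBall]
  | succ j ih =>
    intro w hw
    rw [mem_arcBall_succ] at hw ⊢
    rcases hw with hw | ⟨e, he, -, rfl⟩
    · exact Or.inl (ih hw)
    · exact Or.inr ⟨e, ih he, by simp, rfl⟩

lemma card_arcBall_le (j : ℕ) : (arcBall f T v j).card ≤ (k + 1) ^ j := by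
  induction j with
  | zero => simp [arcBall]
  | succ j ih =>
    rw [arcBall]
    refine (Finset.card_union_le _ _).trans ?_
    have h1 : (((arcBall f T v j ×ˢ Finset.univ) \ T).image f).card
        ≤ (arcBall f T v j).card * k := by
      refine Finset.card_image_le.trans ((Finset.card_le_card Finset.sdiff_subset).trans ?_)
      simp
    rw [pow_succ]
    nlinarith

lemma arcBall_congr {j : ℕ} (h : ∀ i < j, ∀ e : Fin n × Fin k, e.1 ∈ arcBall f T v i → e ∉ T →
    g e = f e) : arcBall g T v j = arcBall f T v j := by
  induction j with
  | zero => rfl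
  | succ j ih =>
    have hj := ih fun i hi => h i (by omega)
    ext w
    rw [mem_arcBall_succ, mem_arcBall_succ, hj]
    refine or_congr_right (exists_congr fun e => ?_)
    refine and_congr_right fun h1 => and_congr_right fun h2 => ?_
    rw [h j (by omega) e h1 h2]

lemma exists_path_of_mem_arcBall {j : ℕ} (h : w ∈ arcBall f ∅ v j) :
    ∃ m ≤ j, ∃ c : Fin (m + 1) → Fin n, c 0 = v ∧ c (Fin.last m) = w ∧
      ∀ l : Fin m, ∃ i : Fin k, f (c l.castSucc, i) = c l.succ := by
  induction j generalizing w with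
  | zero =>
    simp only [arcBall, Finset.mem_singleton] at h
    exact ⟨0, le_rfl, fun _ => v, rfl, h.symm, fun l => l.elim0⟩
  | succ j ih =>
    rcases mem_arcBall_succ.1 h with h | ⟨e, he, -, rfl⟩
    · obtain ⟨m, hm, c, hc⟩ := ih h
      exact ⟨m, by omega, c, hc⟩
    · obtain ⟨m, hm, c, h0, hl, hs⟩ := ih he
      refine ⟨m + 1, by omega, Fin.snoc c (f e), ?_, by simp, ?_⟩
      · rw [show (0 : Fin (m + 1 + 1)) = Fin.castSucc 0 from rfl, Fin.snoc_castSucc, h0]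
      · intro l
        refine Fin.lastCases ?_ (fun l => ?_) l
        · refine ⟨e.2, ?_⟩
          rw [Fin.succ_last, Fin.snoc_last, Fin.snoc_castSucc, hl]
        · obtain ⟨i, hi⟩ := hs l
          refine ⟨i, ?_⟩
          rw [Fin.succ_castSucc, Fin.snoc_castSucc, Fin.snoc_castSucc, hi]

/-- Two distinct arcs that start and end in the ball that remains after deleting them. -/
def HasTwoExtraArcs (f : Fin n × Fin k → Fin n) (v : Fin n) (j : ℕ) : Prop :=
  ∃ e e' : Fin n × Fin k, e ≠ e' ∧ ∀ a ∈ ({e, e'} : Finset (Fin n × Fin k)),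
    a.1 ∈ arcBall f {e, e'} v j ∧ f a ∈ arcBall f {e, e'} v j

lemma mul_card_arcBall_le {r : ℕ} (h : ¬ HasTwoExtraArcs f v r) {j : ℕ} (hj : j < r) :
    k * (arcBall f ∅ v j).card ≤ (arcBall f ∅ v (j + 1)).card := by
  have hpar : ∀ w : Fin n, ∃ e : Option (Fin n × Fin k), ∀ j, w ∈ arcBall f ∅ v (j + 1) →
      w ∉ arcBall f ∅ v j → ∃ a, e = some a ∧ a.1 ∈ arcBall f ∅ v j ∧ f a = w := by
    intro w
    by_cases hw : ∃ j, w ∈ arcBall f ∅ v (j + 1) ∧ w ∉ arcBall f ∅ v j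
    · obtain ⟨j, h1, h2⟩ := hw
      rcases mem_arcBall_succ.1 h1 with h3 | ⟨a, ha, -, hfa⟩
      · exact absurd h3 h2
      refine ⟨some a, fun j' h1' h2' => ⟨a, rfl, ?_, hfa⟩⟩
      have e1 : ¬ j + 1 ≤ j' := fun hle => h2' (arcBall_mono hle h1)
      have e2 : ¬ j' + 1 ≤ j := fun hle => h2 (arcBall_mono hle h1')
      obtain rfl : j = j' := by omega
      exact ha
    · push Not at hw
      exact ⟨none, fun j h1 h2 => absurd (hw j h1) h2⟩
  choose p hp using hpar
  have hball : ∀ T : Finset (Fin n × Fin k), (∀ e ∈ T, f e ≠ v → p (f e) ≠ some e) →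
      ∀ j,
      arcBall f ∅ v j ⊆ arcBall f T v j := by
    intro T hT j
    induction j with
    | zero => simp [arcBall]
    | succ j ih =>
      intro w hw
      by_cases hwj : w ∈ arcBall f ∅ v j
      · exact arcBall_mono (Nat.le_succ j) (ih hwj)
      · obtain ⟨a, ha, ha1, hfa⟩ := hp w j hw hwj
        refine mem_arcBall_succ.2 (Or.inr ⟨a, ih ha1, fun haT => hT a haT ?_ ?_, hfa⟩)
        · rintro hv
          rw [← hfa, hv] at hwj
          exact hwj (self_mem_arcBall j)
        · rw [hfa, ha]
  have hsub : ∀ j < r, ((arcBall f ∅ v j ×ˢ (Finset.univ : Finset (Fin k))).filter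
      fun e => ¬ (f e ≠ v ∧ p (f e) = some e)).card ≤ 1 := by
    intro j hj
    rw [Finset.card_le_one]
    intro e he e' he'
    by_contra hne
    have key : ∀ a ∈ ({e, e'} : Finset (Fin n × Fin k)), a.1 ∈ arcBall f ∅ v j ∧
        (f a ≠ v → p (f a) ≠ some a) := by
      intro a ha
      simp only [Finset.mem_insert, Finset.mem_singleton] at ha
      simp only [Finset.mem_filter, Finset.mem_product, Finset.mem_univ, and_true, not_and] at he he'
      rcases ha with rfl | rfl
      · exact he
      · exact he'
    refine h ⟨e, e', hne, fun a ha => ?_⟩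
    have hT := hball {e, e'} fun a ha => (key a ha).2
    exact ⟨hT r (arcBall_mono hj.le (key a ha).1),
      hT r (arcBall_mono hj (mem_arcBall_succ.2 (Or.inr ⟨a, (key a ha).1, by simp, rfl⟩)))⟩
  have htree : ((arcBall f ∅ v j ×ˢ (Finset.univ : Finset (Fin k))).filter
      fun e => f e ≠ v ∧ p (f e) = some e).card ≤ ((arcBall f ∅ v (j + 1)).erase v).card := by
    refine Finset.card_le_card_of_injOn f ?_ ?_
    · intro e he
      simp only [Finset.coe_filter, Finset.mem_product, Finset.mem_univ, and_true,
        Set.mem_ofPred_eq] at he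
      simp only [Finset.coe_erase, Set.mem_sdiff, Finset.mem_coe, Set.mem_singleton_iff]
      exact ⟨mem_arcBall_succ.2 (Or.inr ⟨e, he.1, by simp, rfl⟩), he.2.1⟩
    · intro e he e' he' hee
      simp only [Finset.coe_filter, Set.mem_ofPred_eq] at he he'
      have := he.2.2
      rw [hee, he'.2.2] at this
      exact (Option.some.inj this).symm
  have hcard := Finset.card_filter_add_card_filter_not
    (s := arcBall f ∅ v j ×ˢ (Finset.univ : Finset (Fin k)))
    (fun e => f e ≠ v ∧ p (f e) = some e)
  rw [Finset.card_product, Finset.card_univ, Fintype.card_fin] at hcard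
  rw [Finset.card_erase_of_mem (self_mem_arcBall _)] at htree
  have hpos : 0 < (arcBall f ∅ v (j + 1)).card :=
    Finset.card_pos.2 ⟨v, self_mem_arcBall _⟩
  have := hsub j hj
  rw [mul_comm]
  omega

lemma pow_le_card_arcBall_sdiff (hk : 2 ≤ k) {q : ℕ} (h : ¬ HasTwoExtraArcs f v (q + 1)) :
    k ^ q ≤ (arcBall f ∅ v (q + 1) \ arcBall f ∅ v q).card := by
  have hpow : ∀ j ≤ q, k ^ j ≤ (arcBall f ∅ v j).card := by
    intro j hj
    induction j with
    | zero => simp [arcBall]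
    | succ j ih =>
      have h1 := mul_card_arcBall_le h (j := j) (by omega)
      have h2 := ih (by omega)
      rw [pow_succ]
      nlinarith
  have h1 := mul_card_arcBall_le h (j := q) (by omega)
  have h2 := hpow q le_rfl
  have h3 := Finset.le_card_sdiff (arcBall f ∅ v q) (arcBall f ∅ v (q + 1))
  have h4 := Nat.mul_le_mul_right (arcBall f ∅ v q).card hk
  omega

end ArcBall

lemma prob_hasTwoExtraArcs_le {n k : ℕ} [NeZero n] (v : Fin n) (r : ℕ) :
    prob n k (fun f => HasTwoExtraArcs f v r) ≤ (k * ((k + 1) ^ r) ^ 2 / n) ^ 2 := by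
  set K : ℝ := ((k : ℝ) + 1) ^ r with hK
  have hcard : ∀ (f : Fin n × Fin k → Fin n) T, ((arcBall f T v r).card : ℝ) ≤ K := by
    intro f T
    have := card_arcBall_le (f := f) (T := T) (v := v) r
    rw [hK]; exact_mod_cast this
  let I : Finset ((Fin n × Fin k) × (Fin n × Fin k)) := Finset.univ.filter fun x => x.1 ≠ x.2
  have key : ∀ x ∈ I, prob n k (fun f =>
      (∀ a ∈ ({x.1, x.2} : Finset (Fin n × Fin k)), a.1 ∈ arcBall f {x.1, x.2} v r) ∧
      ∀ a ∈ ({x.1, x.2} : Finset (Fin n × Fin k)), f a ∈ arcBall f {x.1, x.2} v r)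
      ≤ (K / n) ^ 2 * prob n k (fun f => x.1.1 ∈ arcBall f ∅ v r ∧ x.2.1 ∈ arcBall f ∅ v r) := by
    intro x hx
    have hne : x.1 ≠ x.2 := by simpa [I] using hx
    have hcongr : ∀ f g : Fin n × Fin k → Fin n,
        (∀ i, i ∉ ({x.1, x.2} : Finset (Fin n × Fin k)) → g i = f i) →
        arcBall g {x.1, x.2} v r = arcBall f {x.1, x.2} v r :=
      fun f g h => arcBall_congr fun _ _ e _ he => h e he
    refine (prob_resample_le (fun _ => {x.1, x.2}) _ (fun f => arcBall f {x.1, x.2} v r)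
      (fun _ _ _ _ => rfl) ?_ (fun f g _ h => hcongr f g h) ((K / n) ^ 2) ?_).trans ?_
    · intro f g hf h a ha
      rw [hcongr f g h]
      exact hf a ha
    · intro f _
      rw [Finset.card_pair hne]
      gcongr
      exact hcard f _
    · gcongr
      refine prob_mono fun f hf => ⟨?_, ?_⟩
      · exact arcBall_subset r (hf x.1 (by simp))
      · exact arcBall_subset r (hf x.2 (by simp))
  have hsum : ∑ x ∈ I, prob n k (fun f => x.1.1 ∈ arcBall f ∅ v r ∧ x.2.1 ∈ arcBall f ∅ v r)
      ≤ (k * K) ^ 2 := by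
    rw [sum_prob_eq]
    have hΩ : (0 : ℝ) < Fintype.card (Fin n × Fin k → Fin n) := by
      exact_mod_cast Fintype.card_pos
    rw [div_le_iff₀ hΩ]
    calc _ ≤ ∑ f : Fin n × Fin k → Fin n, (k * K) ^ 2 := by
          refine Finset.sum_le_sum fun f _ => ?_
          have h1 : (I.filter fun x => x.1.1 ∈ arcBall f ∅ v r ∧ x.2.1 ∈ arcBall f ∅ v r) ⊆
              (arcBall f ∅ v r ×ˢ Finset.univ) ×ˢ (arcBall f ∅ v r ×ˢ Finset.univ) := by
            intro x hx
            simpa using (Finset.mem_filter.1 hx).2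
          have h2 := Finset.card_le_card h1
          simp only [Finset.card_product, Finset.card_univ, Fintype.card_fin] at h2
          have h3 := hcard f ∅
          calc _ ≤ (((arcBall f ∅ v r).card * k * ((arcBall f ∅ v r).card * k) : ℕ) : ℝ) := by
                refine Nat.cast_le.2 (le_trans (le_of_eq ?_) h2)
                congr!
            _ = (k * (arcBall f ∅ v r).card) ^ 2 := by push_cast; ring
            _ ≤ _ := by gcongr
      _ = _ := by
          rw [Finset.sum_const, Finset.card_univ, nsmul_eq_mul, mul_comm]
  calc prob n k (fun f => HasTwoExtraArcs f v r)
      ≤ prob n k (fun f => ∃ x ∈ I,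
        (∀ a ∈ ({x.1, x.2} : Finset (Fin n × Fin k)), a.1 ∈ arcBall f {x.1, x.2} v r) ∧
        ∀ a ∈ ({x.1, x.2} : Finset (Fin n × Fin k)), f a ∈ arcBall f {x.1, x.2} v r) := by
        refine prob_mono fun f hf => ?_
        obtain ⟨e, e', hne, h⟩ := hf
        exact ⟨(e, e'), by simp [I, hne], fun a ha => (h a ha).1, fun a ha => (h a ha).2⟩
    _ ≤ ∑ x ∈ I, (K / n) ^ 2 *
        prob n k (fun f => x.1.1 ∈ arcBall f ∅ v r ∧ x.2.1 ∈ arcBall f ∅ v r) :=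
        (prob_exists_le I _).trans (Finset.sum_le_sum key)
    _ ≤ (K / n) ^ 2 * (k * K) ^ 2 := by
        rw [← Finset.mul_sum]
        gcongr
    _ = _ := by ring

/-! ### Hitting large reachable sets -/

/-- The vertices reachable from `s`. -/
noncomputable def reachSet {n k : ℕ} (f : Fin n × Fin k → Fin n) (s : Fin n) : Finset (Fin n) :=
  Finset.univ.filter (Reaches f s)

lemma mem_reachSet {n k : ℕ} {f : Fin n × Fin k → Fin n} {s w : Fin n} :
    w ∈ reachSet f s ↔ Reaches f s w := by
  simp [reachSet]

lemma isClosedSet_reachSet {n k : ℕ} (f : Fin n × Fin k → Fin n) (s : Fin n) :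
    IsClosedSet f (reachSet f s : Set (Fin n)) := by
  intro w hw i
  rw [Finset.mem_coe, mem_reachSet] at hw ⊢
  exact hw.tail ⟨i, rfl⟩

lemma reachSet_congr {n k : ℕ} {f g : Fin n × Fin k → Fin n} {s : Fin n}
    (h : ∀ e : Fin n × Fin k, e.1 ∈ reachSet f s → g e = f e) : reachSet g s = reachSet f s := by
  ext w
  rw [mem_reachSet, mem_reachSet]
  constructor
  · intro hw
    induction hw with
    | refl => exact .refl
    | tail _ hst ih =>
      obtain ⟨i, rfl⟩ := hst
      exact ih.tail ⟨i, (h _ (mem_reachSet.2 ih)).symm⟩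
  · intro hw
    induction hw with
    | refl => exact .refl
    | tail hw hst ih =>
      obtain ⟨i, rfl⟩ := hst
      exact ih.tail ⟨i, h _ (mem_reachSet.2 hw)⟩

lemma prob_disjoint_reachSet_le {n k : ℕ} [NeZero n] (v s : Fin n) (q : ℕ) :
    prob n k (fun f => k ^ q ≤ (arcBall f ∅ v (q + 1) \ arcBall f ∅ v q).card ∧
      n ≤ 12 * (reachSet f s).card ∧ Disjoint (reachSet f s) (arcBall f ∅ v (q + 2)))
      ≤ (11 / 12 : ℝ) ^ (k ^ (q + 1)) := by
  have hn : (0 : ℝ) < n := by exact_mod_cast NeZero.pos n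
  let B : (Fin n × Fin k → Fin n) → Finset (Fin n) :=
    fun f => arcBall f ∅ v (q + 1) \ arcBall f ∅ v q
  let E : (Fin n × Fin k → Fin n) → Prop := fun f =>
    k ^ q ≤ (B f).card ∧ n ≤ 12 * (reachSet f s).card ∧ Disjoint (reachSet f s) (B f)
  have hball : ∀ f g : Fin n × Fin k → Fin n,
      (∀ i, i ∉ B f ×ˢ (Finset.univ : Finset (Fin k)) → g i = f i) →
      ∀ j ≤ q + 1, arcBall g ∅ v j = arcBall f ∅ v j := by
    intro f g h j hj
    refine arcBall_congr fun i hi e he _ => h e fun heB => ?_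
    simp only [B, Finset.mem_product, Finset.mem_sdiff, Finset.mem_univ, and_true] at heB
    exact heB.2 (arcBall_mono (by omega) he)
  have hB : ∀ f g : Fin n × Fin k → Fin n,
      (∀ i, i ∉ B f ×ˢ (Finset.univ : Finset (Fin k)) → g i = f i) → B g = B f := by
    intro f g h
    simp only [B]
    rw [hball f g h _ le_rfl, hball f g h q (by omega)]
  have hR : ∀ f g : Fin n × Fin k → Fin n, E f →
      (∀ i, i ∉ B f ×ˢ (Finset.univ : Finset (Fin k)) → g i = f i) →
      reachSet g s = reachSet f s := by
    intro f g hf h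
    refine reachSet_congr fun e he => h e fun heB => ?_
    exact Finset.disjoint_left.1 hf.2.2 he (Finset.mem_product.1 heB).1
  have main := prob_resample_le (fun f => B f ×ˢ (Finset.univ : Finset (Fin k))) E
    (fun f => (reachSet f s)ᶜ) (fun f g _ h => by rw [hB f g h]) ?_
    (fun f g hf h => by rw [hR f g hf h]) ((11 / 12 : ℝ) ^ (k ^ (q + 1))) ?_
  · refine le_trans (prob_mono fun f hf => ?_)
      (main.trans (mul_le_of_le_one_right (by positivity) (prob_le_one _)))
    obtain ⟨h1, h2, h3⟩ := hf
    refine ⟨⟨h1, h2, Finset.disjoint_of_subset_right ?_ h3⟩, fun e he => ?_⟩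
    · exact Finset.sdiff_subset.trans (arcBall_mono (Nat.le_succ _))
    · rw [Finset.mem_compl]
      refine Finset.disjoint_right.1 h3 (mem_arcBall_succ.2 (Or.inr ⟨e, ?_, by simp, rfl⟩))
      simp only [B, Finset.mem_product, Finset.mem_sdiff] at he
      exact he.1.1
  · intro f g hf h
    have h1 := hB f g h
    have h2 := hR f g hf h
    simp only [E] at hf ⊢
    rwa [h1, h2]
  · intro f hf
    have hcompl : (((reachSet f s)ᶜ.card : ℕ) : ℝ) / n ≤ 11 / 12 := by
      rw [div_le_iff₀ hn, Finset.card_compl, Fintype.card_fin,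
        Nat.cast_sub (by simpa using (reachSet f s).card_le_univ)]
      have : (n : ℝ) ≤ 12 * (reachSet f s).card := by exact_mod_cast hf.2.1
      linarith
    calc _ ≤ (11 / 12 : ℝ) ^ (B f ×ˢ (Finset.univ : Finset (Fin k))).card := by gcongr
      _ ≤ _ := by
        refine pow_le_pow_of_le_one (by norm_num) (by norm_num) ?_
        rw [Finset.card_product, Finset.card_univ, Fintype.card_fin, pow_succ]
        exact Nat.mul_le_mul_right _ hf.1

/-- With high probability every vertex is close to every nonempty closed set. -/
lemma prob_exists_far_isClosedSet_le {n k : ℕ} (hk : 2 ≤ k) [NeZero n] (q : ℕ) :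
    prob n k (fun f => ∃ (v : Fin n) (S : Finset (Fin n)), S.Nonempty ∧
      IsClosedSet f (S : Set (Fin n)) ∧ Disjoint S (arcBall f ∅ v (q + 2)))
      ≤ 6 / n + n * (k * ((k + 1) ^ (q + 1)) ^ 2 / n) ^ 2
        + n ^ 2 * (11 / 12 : ℝ) ^ (k ^ (q + 1)) := by
  refine le_trans (prob_mono (Q := fun f => ((∃ S : Finset (Fin n), S.Nonempty ∧
      12 * S.card ≤ n ∧ IsClosedSet f (S : Set (Fin n))) ∨
      ∃ v ∈ (Finset.univ : Finset (Fin n)), HasTwoExtraArcs f v (q + 1)) ∨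
      ∃ x ∈ (Finset.univ : Finset (Fin n × Fin n)),
        k ^ q ≤ (arcBall f ∅ x.1 (q + 1) \ arcBall f ∅ x.1 q).card ∧
        n ≤ 12 * (reachSet f x.2).card ∧
        Disjoint (reachSet f x.2) (arcBall f ∅ x.1 (q + 2))) ?_) ?_
  · rintro f ⟨v, S, ⟨s, hs⟩, hcl, hd⟩
    by_contra! hcon
    obtain ⟨⟨h1, h2⟩, h3⟩ := hcon
    have hsub : reachSet f s ⊆ S := by
      intro w hw
      rw [mem_reachSet] at hw
      induction hw with
      | refl => exact hs
      | tail _ hst ih =>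
        obtain ⟨i, rfl⟩ := hst
        exact hcl _ ih i
    refine h3 (v, s) (Finset.mem_univ _)
      (pow_le_card_arcBall_sdiff hk (h2 v (Finset.mem_univ _))) ?_
      (Finset.disjoint_of_subset_left hsub hd)
    by_contra hlt
    dsimp only at hlt
    exact h1 (reachSet f s) ⟨s, mem_reachSet.2 .refl⟩ (by omega) (isClosedSet_reachSet f s)
  · refine (prob_or_le _ _).trans (add_le_add ((prob_or_le _ _).trans (add_le_add
      (prob_exists_small_isClosedSet_le hk) ?_)) ?_)
    · refine (prob_exists_le _ _).trans
        ((Finset.sum_le_sum fun v _ => prob_hasTwoExtraArcs_le v (q + 1)).trans ?_)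
      simp
    · refine (prob_exists_le _ _).trans
        ((Finset.sum_le_sum fun x _ => prob_disjoint_reachSet_le x.1 x.2 q).trans ?_)
      simp [sq]

/-! ### Heap-shaped trees that nothing else enters -/

/-- The image of `φ` is a `k`-ary heap-shaped tree with `t` internal nodes (node `a` has children
`k * a + 1, …, k * a + k`) and no arc other than the tree arcs enters it. -/
def IsHeap {n k t : ℕ} (φ : Fin (k * t + 1) ↪ Fin n) (f : Fin n × Fin k → Fin n) : Prop :=
  (∀ (a b : Fin (k * t + 1)) (i : Fin k), (b : ℕ) = k * a + i + 1 → f (φ a, i) = φ b) ∧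
  ∀ (x : Fin n) (i : Fin k) (b : Fin (k * t + 1)), f (x, i) = φ b →
    ∃ a, x = φ a ∧ (b : ℕ) = k * a + i + 1

lemma heap_child_lt {k t a : ℕ} (i : Fin k) : k * a + i + 1 < k * t + 1 ↔ a < t := by
  have hi := i.isLt
  constructor
  · intro h
    by_contra hle
    have := Nat.mul_le_mul_left k (not_lt.1 hle)
    omega
  · intro h
    have := Nat.mul_le_mul_left k (Nat.succ_le_of_lt h)
    rw [Nat.mul_succ] at this
    omega

section Heap

variable {n k t : ℕ} {φ ψ : Fin (k * t + 1) ↪ Fin n} {f : Fin n × Fin k → Fin n}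

lemma heap_exists_parent (hk : 0 < k) (b : Fin (k * t + 1)) (hb : (b : ℕ) ≠ 0) :
    ∃ (a : Fin (k * t + 1)) (i : Fin k), (a : ℕ) < b ∧ (b : ℕ) = k * a + i + 1 := by
  have h1 := Nat.div_add_mod ((b : ℕ) - 1) k
  have h2 := Nat.mod_lt ((b : ℕ) - 1) hk
  have h3 : ((b : ℕ) - 1) / k ≤ b - 1 := Nat.div_le_self _ _
  refine ⟨⟨((b : ℕ) - 1) / k, by omega⟩, ⟨((b : ℕ) - 1) % k, h2⟩, ?_, ?_⟩
  · dsimp only; omega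
  · dsimp only; omega

lemma IsHeap.eq_of_apply_eq (hk : 0 < k) (hφ : IsHeap φ f) (hψ : IsHeap ψ f) :
    ∀ (a b : Fin (k * t + 1)), φ a = ψ b → a = b ∧ φ 0 = ψ 0 := by
  suffices h : ∀ (m : ℕ) (a b : Fin (k * t + 1)), (a : ℕ) = m → φ a = ψ b → a = b ∧ φ 0 = ψ 0 from
    fun a b => h a a b rfl
  intro m
  induction m using Nat.strong_induction_on with
  | _ m ih =>
    intro a b ha hab
    by_cases h0 : (a : ℕ) = 0
    · by_cases hb : (b : ℕ) = 0
      · have e1 : a = 0 := Fin.ext h0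
        have e2 : b = 0 := Fin.ext hb
        subst e1 e2
        exact ⟨rfl, hab⟩
      · obtain ⟨c, i, -, hc⟩ := heap_exists_parent hk b hb
        obtain ⟨d, -, hd⟩ := hφ.2 (ψ c) i a (by rw [hψ.1 c b i hc, hab])
        omega
    · obtain ⟨c, i, hca, hc⟩ := heap_exists_parent hk a h0
      obtain ⟨d, hd, hbd⟩ := hψ.2 (φ c) i b (by rw [hφ.1 c a i hc, hab])
      obtain ⟨rfl, h00⟩ := ih c (by omega) c d rfl hd
      exact ⟨Fin.ext (by omega), h00⟩

lemma IsHeap.disjoint_of_ne (hk : 0 < k) (hφ : IsHeap φ f) (hψ : IsHeap ψ f) (hne : φ ≠ ψ)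
    (a b : Fin (k * t + 1)) : φ a ≠ ψ b := by
  intro hab
  have h0 := (hφ.eq_of_apply_eq hk hψ a b hab).2
  apply hne
  have : ∀ (m : ℕ) (a : Fin (k * t + 1)), (a : ℕ) = m → φ a = ψ a := by
    intro m
    induction m using Nat.strong_induction_on with
    | _ m ih =>
      intro a ha
      by_cases ha0 : (a : ℕ) = 0
      · rwa [show a = 0 from Fin.ext ha0]
      · obtain ⟨c, i, hca, hc⟩ := heap_exists_parent hk a ha0
        rw [← hφ.1 c a i hc, ← hψ.1 c a i hc, ih c (by omega) c rfl]
  exact DFunLike.ext _ _ fun a => this a.val a rfl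

lemma IsHeap.notMem_of_isClosedSet (hk : 0 < k) (hφ : IsHeap φ f) {G : Set (Fin n)}
    (hcl : IsClosedSet f G) (hsc : IsStrConn f G) (a : Fin (k * t + 1)) : φ a ∉ G := by
  suffices h : ∀ (m : ℕ) (a : Fin (k * t + 1)), (a : ℕ) = m → φ a ∉ G from h a a rfl
  intro m
  induction m using Nat.strong_induction_on with
  | _ m ih =>
    intro a ha haG
    obtain ⟨x, hxG, i, hxi⟩ : ∃ x ∈ G, ∃ i, f (x, i) = φ a := by
      have hy := hcl _ haG ⟨0, hk⟩
      have hr := hsc.2 _ hy _ haG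
      rcases Relation.ReflTransGen.cases_tail hr with heq | ⟨x, hx, i, hi⟩
      · exact ⟨φ a, haG, _, heq.symm⟩
      · refine ⟨x, ?_, i, hi⟩
        clear hi hr
        induction hx with
        | refl => exact hy
        | tail _ hst ih' =>
          obtain ⟨j, rfl⟩ := hst
          exact hcl _ ih' j
    obtain ⟨b, rfl, hb⟩ := hφ.2 x i a hxi
    have : (b : ℕ) ≤ k * b := Nat.le_mul_of_pos_left _ hk
    exact ih b (by omega) b rfl hxG

/-- Walks from the root of a heap stay in the heap for about `log_k t` steps. -/
lemma IsHeap.walk_mem (hk : 2 ≤ k) (hφ : IsHeap φ f) {m l : ℕ} (ht : 2 * k ^ m ≤ t)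
    (hl : l ≤ m) (c : Fin (l + 1) → Fin n) (h0 : c 0 = φ 0)
    (hc : ∀ j : Fin l, ∃ i : Fin k, f (c j.castSucc, i) = c j.succ) :
    ∃ a, c (Fin.last l) = φ a := by
  have key : ∀ j : ℕ, ∀ hj : j < l + 1, ∃ a : Fin (k * t + 1), c ⟨j, hj⟩ = φ a ∧
      (a : ℕ) + 2 ≤ 2 * k ^ j := by
    intro j
    induction j with
    | zero => exact fun hj => ⟨0, h0, by simp⟩
    | succ j ih =>
      intro hj
      obtain ⟨a, ha, ha2⟩ := ih (by omega)
      obtain ⟨i, hi⟩ := hc ⟨j, by omega⟩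
      have hpow : k ^ j ≤ k ^ m := Nat.pow_le_pow_right (by omega) (by omega)
      have hat : (a : ℕ) < t := by omega
      refine ⟨⟨k * a + i + 1, (heap_child_lt i).2 hat⟩, ?_, ?_⟩
      · rw [← hφ.1 a _ i rfl, ← ha]
        exact hi.symm
      · have := i.isLt
        have h2 : k * (a + 2) ≤ k * (2 * k ^ j) := Nat.mul_le_mul_left k ha2
        rw [pow_succ]
        dsimp only
        nlinarith
  obtain ⟨a, ha, -⟩ := key l (Nat.lt_succ_self l)
  exact ⟨a, ha⟩

/-- The arcs of the tree with node set `φ`. -/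
noncomputable def heapArcs (φ : Fin (k * t + 1) ↪ Fin n) : Finset (Fin n × Fin k) :=
  (Finset.univ.filter fun a : Fin (k * t + 1) => (a : ℕ) < t).map φ ×ˢ Finset.univ

lemma mem_heapArcs {e : Fin n × Fin k} :
    e ∈ heapArcs φ ↔ ∃ a : Fin (k * t + 1), (a : ℕ) < t ∧ φ a = e.1 := by
  simp [heapArcs]

lemma card_heapArcs (hk : 0 < k) (φ : Fin (k * t + 1) ↪ Fin n) : (heapArcs φ).card = k * t := by
  rw [heapArcs, Finset.card_product, Finset.card_map, Fin.card_filter_val_lt]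
  have : t ≤ k * t := Nat.le_mul_of_pos_left _ hk
  rw [min_eq_right (by omega), Finset.card_univ, Fintype.card_fin, mul_comm]

lemma card_filter_prescribed {ι β : Type*} [Fintype ι] [Fintype β] (J : Finset ι) (g : ι → β)
    (U : Finset β) : (Finset.univ.filter fun f : ι → β =>
      ∀ e, (e ∈ J → f e = g e) ∧ (e ∉ J → f e ∈ U)).card = U.card ^ (Fintype.card ι - J.card) := by
  have : Finset.univ.filter (fun f : ι → β => ∀ e, (e ∈ J → f e = g e) ∧ (e ∉ J → f e ∈ U))
      = Fintype.piFinset fun e => if e ∈ J then {g e} else U := by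
    ext f
    simp only [Finset.mem_filter, Finset.mem_univ, true_and, Fintype.mem_piFinset]
    refine forall_congr' fun e => ?_
    by_cases he : e ∈ J <;> simp [he]
  rw [this, Fintype.card_piFinset]
  simp only [apply_ite Finset.card, Finset.card_singleton]
  rw [Finset.prod_ite]
  simp only [Finset.prod_const_one, one_mul, Finset.prod_const]
  rw [← Finset.card_compl]
  congr 2
  ext; simp

lemma le_prob_isHeap (hk : 0 < k) (φ : Fin (k * t + 1) ↪ Fin n) :
    ((n - (k * t + 1) : ℕ) : ℝ) ^ (n * k - k * t) / (n : ℝ) ^ (n * k) ≤ prob n k (IsHeap φ) := by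
  rw [prob]
  have hΩ : (Fintype.card (Fin n × Fin k → Fin n) : ℝ) = (n : ℝ) ^ (n * k) := by simp
  rw [hΩ]
  gcongr
  let g : Fin n × Fin k → Fin n := fun e =>
    if h : ∃ a : Fin (k * t + 1), (a : ℕ) < t ∧ φ a = e.1 then
      φ ⟨k * h.choose + e.2 + 1, (heap_child_lt e.2).2 h.choose_spec.1⟩ else e.1
  have hg : ∀ (a : Fin (k * t + 1)) (i : Fin k) (h : (a : ℕ) < t),
      g (φ a, i) = φ ⟨k * a + i + 1, (heap_child_lt i).2 h⟩ := by
    intro a i h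
    have hex : ∃ b : Fin (k * t + 1), (b : ℕ) < t ∧ φ b = (φ a, i).1 := ⟨a, h, rfl⟩
    have heq : hex.choose = a := φ.injective hex.choose_spec.2
    simp only [g, dif_pos hex]
    congr 2
    rw [heq]
  have hc := card_filter_prescribed (heapArcs φ) g ((Finset.univ.map φ)ᶜ)
  rw [card_heapArcs hk, Finset.card_compl, Finset.card_map, Finset.card_univ, Fintype.card_fin,
    Fintype.card_prod, Fintype.card_fin, Fintype.card_fin, Fintype.card_fin] at hc
  rw [← Nat.cast_pow, ← hc, Nat.cast_le]
  refine Finset.card_le_card fun f hf => ?_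
  simp only [Finset.mem_filter, Finset.mem_univ, true_and] at hf ⊢
  constructor
  · intro a b i hb
    have hat : (a : ℕ) < t := (heap_child_lt i).1 (hb ▸ b.isLt)
    rw [(hf (φ a, i)).1 (mem_heapArcs.2 ⟨a, hat, rfl⟩), hg a i hat]
    congr 1
    exact Fin.ext hb.symm
  · intro x i b hb
    by_cases hx : (x, i) ∈ heapArcs φ
    · obtain ⟨a, hat, rfl⟩ := mem_heapArcs.1 hx
      refine ⟨a, rfl, ?_⟩
      rw [(hf _).1 hx, hg a i hat] at hb
      have := φ.injective hb
      rw [← this]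
    · have := (hf _).2 hx
      rw [hb] at this
      simp at this

lemma prob_isHeap_and_le (hk : 0 < k) (hne : φ ≠ ψ) :
    prob n k (fun f => IsHeap φ f ∧ IsHeap ψ f)
      ≤ ((n - 2 * (k * t + 1) : ℕ) : ℝ) ^ (n * k - 2 * (k * t)) / (n : ℝ) ^ (n * k) := by
  rw [prob_eq]
  have hΩ : (Fintype.card (Fin n × Fin k → Fin n) : ℝ) = (n : ℝ) ^ (n * k) := by simp
  rw [hΩ]
  gcongr
  rw [← Nat.cast_pow, Nat.cast_le]
  rcases Finset.eq_empty_or_nonempty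
    (Finset.univ.filter fun f => IsHeap φ f ∧ IsHeap ψ f) with h | ⟨g, hg⟩
  · rw [h]; simp
  simp only [Finset.mem_filter, Finset.mem_univ, true_and] at hg
  have hd : Disjoint ((Finset.univ : Finset (Fin (k * t + 1))).map φ) (Finset.univ.map ψ) := by
    rw [Finset.disjoint_left]
    intro x hx hx'
    simp only [Finset.mem_map, Finset.mem_univ, true_and] at hx hx'
    obtain ⟨a, rfl⟩ := hx
    obtain ⟨b, hb⟩ := hx'
    exact hg.1.disjoint_of_ne hk hg.2 hne a b hb.symm
  have hd' : Disjoint (heapArcs φ) (heapArcs ψ) := by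
    rw [Finset.disjoint_left]
    intro x hx hx'
    obtain ⟨a, -, ha⟩ := mem_heapArcs.1 hx
    obtain ⟨b, -, hb⟩ := mem_heapArcs.1 hx'
    exact hg.1.disjoint_of_ne hk hg.2 hne a b (ha.trans hb.symm)
  have hc := card_filter_prescribed (heapArcs φ ∪ heapArcs ψ) g
    ((Finset.univ.map φ ∪ Finset.univ.map ψ)ᶜ)
  rw [Finset.card_union_of_disjoint hd', card_heapArcs hk, card_heapArcs hk, Finset.card_compl,
    Finset.card_union_of_disjoint hd, Finset.card_map, Finset.card_map, Finset.card_univ,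
    Fintype.card_fin, Fintype.card_prod, Fintype.card_fin, Fintype.card_fin, Fintype.card_fin,
    ← two_mul, ← two_mul] at hc
  rw [← hc]
  refine Finset.card_le_card fun f hf => ?_
  simp only [Finset.mem_filter, Finset.mem_univ, true_and] at hf ⊢
  have agree : ∀ χ : Fin (k * t + 1) ↪ Fin n, IsHeap χ f → IsHeap χ g →
      ∀ e ∈ heapArcs χ, f e = g e := by
    rintro χ h1 h2 ⟨x, i⟩ he
    obtain ⟨a, hat, rfl⟩ := mem_heapArcs.1 he
    rw [h1.1 a ⟨_, (heap_child_lt i).2 hat⟩ i rfl, h2.1 a ⟨_, (heap_child_lt i).2 hat⟩ i rfl]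
  have avoid : ∀ χ : Fin (k * t + 1) ↪ Fin n, IsHeap χ f →
      ∀ e ∉ heapArcs χ, f e ∉ Finset.univ.map χ := by
    rintro χ h1 ⟨x, i⟩ he hmem
    simp only [Finset.mem_map, Finset.mem_univ, true_and] at hmem
    obtain ⟨b, hb⟩ := hmem
    obtain ⟨a, rfl, hab⟩ := h1.2 x i b hb.symm
    exact he (mem_heapArcs.2 ⟨a, (heap_child_lt i).1 (hab ▸ b.isLt), rfl⟩)
  intro e
  refine ⟨fun he => ?_, fun he => ?_⟩
  · rcases Finset.mem_union.1 he with he | he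
    · exact agree φ hf.1 hg.1 e he
    · exact agree ψ hf.2 hg.2 e he
  · rw [Finset.mem_union, not_or] at he
    rw [Finset.mem_compl, Finset.mem_union, not_or]
    exact ⟨avoid φ hf.1 e he.1, avoid ψ hf.2 e he.2⟩

end Heap

/-- Second moment method. -/
lemma prob_forall_not_le {n k : ℕ} [NeZero n] {ι : Type*} [Fintype ι]
    (P : ι → (Fin n × Fin k → Fin n) → Prop) {μ b : ℝ} (hμ : 0 < μ)
    (hμP : μ ≤ ∑ a, prob n k (P a)) (hb : 0 ≤ b)
    (hP : ∀ a a', a ≠ a' → prob n k (fun f => P a f ∧ P a' f) ≤ b) :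
    prob n k (fun f => ∀ a, ¬ P a f) ≤ 1 / μ + (Fintype.card ι) ^ 2 * b / μ ^ 2 - 1 := by
  set M := ∑ a, prob n k (P a) with hM
  have hM0 : 0 < M := hμ.trans_le hμP
  set Ω : ℝ := ((Fintype.card (Fin n × Fin k → Fin n) : ℕ) : ℝ) with hΩdef
  have hΩ : 0 < Ω := by rw [hΩdef]; exact_mod_cast Fintype.card_pos
  let X : (Fin n × Fin k → Fin n) → ℝ := fun f => ((Finset.univ.filter fun a => P a f).card : ℝ)
  have h1 : ∑ f, X f = Ω * M := by
    rw [hM, sum_prob_eq, mul_div_cancel₀ _ hΩ.ne']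
  have h2 : ∑ f, X f ^ 2 ≤ Ω * (M + (Fintype.card ι) ^ 2 * b) := by
    have e1 : ∑ f, X f ^ 2 = Ω * ∑ x : ι × ι, prob n k (fun f => P x.1 f ∧ P x.2 f) := by
      rw [sum_prob_eq (P := fun (x : ι × ι) f => P x.1 f ∧ P x.2 f), mul_div_cancel₀ _ hΩ.ne']
      refine Finset.sum_congr rfl fun f _ => ?_
      simp only [X]
      rw [sq, ← Nat.cast_mul, ← Finset.card_product, ← Finset.univ_product_univ,
        ← Finset.filter_product]
      congr!
    rw [e1]
    gcongr
    have e2 : ∀ x : ι × ι, prob n k (fun f => P x.1 f ∧ P x.2 f)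
        ≤ (if x.1 = x.2 then prob n k (P x.1) else 0) + b := by
      intro x
      split_ifs with h
      · exact (prob_mono fun f hf => hf.1).trans (le_add_of_nonneg_right hb)
      · rw [zero_add]; exact hP _ _ h
    refine (Finset.sum_le_sum fun x _ => e2 x).trans (le_of_eq ?_)
    rw [Finset.sum_add_distrib, Fintype.sum_prod_type]
    congr 1
    · simp [hM]
    · simp [sq]
  have h3 : Ω * prob n k (fun f => ∀ a, ¬ P a f) * M ^ 2 ≤ ∑ f, (X f - M) ^ 2 := by
    rw [prob, mul_div_cancel₀ _ hΩ.ne', ← nsmul_eq_mul, ← Finset.sum_const]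
    refine le_trans (le_of_eq (Finset.sum_congr rfl fun f hf => ?_))
      (Finset.sum_le_sum_of_subset_of_nonneg (Finset.subset_univ _) fun f _ _ => sq_nonneg _)
    have : X f = 0 := by
      simp only [Finset.mem_filter, Finset.mem_univ, true_and] at hf
      simp [X, hf]
    rw [this]; ring
  have h4 : ∑ f, (X f - M) ^ 2 = ∑ f, X f ^ 2 - Ω * M ^ 2 := by
    have : ∀ f, (X f - M) ^ 2 = X f ^ 2 - 2 * M * X f + M ^ 2 := fun f => by ring
    simp only [this]
    rw [Finset.sum_add_distrib, Finset.sum_sub_distrib, ← Finset.mul_sum, h1, Finset.sum_const,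
      Finset.card_univ, nsmul_eq_mul, ← hΩdef]
    ring
  have h5 : prob n k (fun f => ∀ a, ¬ P a f) * M ^ 2 ≤ M + (Fintype.card ι) ^ 2 * b - M ^ 2 := by
    refine le_of_mul_le_mul_left ?_ hΩ
    rw [← mul_assoc, mul_sub]
    exact h3.trans (h4.trans_le (sub_le_sub_right h2 _))
  clear_value M
  calc prob n k (fun f => ∀ a, ¬ P a f)
      ≤ (M + (Fintype.card ι) ^ 2 * b - M ^ 2) / M ^ 2 := by
        rwa [le_div_iff₀ (pow_pos hM0 2)]
    _ = 1 / M + (Fintype.card ι) ^ 2 * b / M ^ 2 - 1 := by field_simp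
    _ ≤ _ := by gcongr

/-- Probability bound for the absence of heap-shaped trees. -/
lemma prob_forall_not_isHeap_le {n k t : ℕ} (hk : 0 < k) (ht : 2 * (k * t + 1) ≤ n) :
    prob n k (fun f => ∀ φ : Fin (k * t + 1) ↪ Fin n, ¬ IsHeap φ f)
      ≤ 2 / n * Real.exp (2 * k * (k * t + 1))
        + (Real.exp (4 * (k * t) * (k * t + 1) / n) - 1) := by
  have hn0 : 0 < n := by omega
  have : NeZero n := ⟨hn0.ne'⟩
  set s := k * t + 1 with hs
  have hn : (0 : ℝ) < n := by exact_mod_cast hn0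
  have hsn : 2 * (s : ℝ) ≤ n := by exact_mod_cast ht
  have hs1 : (s : ℝ) = k * t + 1 := by rw [hs]; push_cast; ring
  have hns : (0 : ℝ) < n - s := by
    have : (0 : ℝ) < s := by rw [hs1]; positivity
    linarith
  have hcast : ((n - s : ℕ) : ℝ) = n - s := Nat.cast_sub (by omega)
  have hcast2 : ((n - 2 * s : ℕ) : ℝ) = n - 2 * s := by
    rw [Nat.cast_sub ht]; push_cast; ring
  have hkn : 2 * (k * t) ≤ n * k := by
    have : n ≤ n * k := Nat.le_mul_of_pos_right _ hk
    omega
  set N : ℝ := ((Fintype.card (Fin s ↪ Fin n) : ℕ) : ℝ) with hN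
  have hNle : ((n : ℝ) - s) ^ s ≤ N := by
    rw [hN, Fintype.card_embedding_eq, Fintype.card_fin, Fintype.card_fin, ← hcast]
    have := Nat.pow_sub_le_descFactorial n s
    have h2 : (n - s) ^ s ≤ (n + 1 - s) ^ s := Nat.pow_le_pow_left (by omega) _
    exact_mod_cast h2.trans this
  have hNpos : 0 < N := lt_of_lt_of_le (by positivity) hNle
  set a : ℝ := ((n : ℝ) - s) ^ (n * k - k * t) / (n : ℝ) ^ (n * k) with ha
  set b : ℝ := ((n : ℝ) - 2 * s) ^ (n * k - 2 * (k * t)) / (n : ℝ) ^ (n * k) with hb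
  have ha0 : 0 < a := by positivity
  have hb0 : 0 ≤ b := div_nonneg (pow_nonneg (by linarith) _) (by positivity)
  have hratio : (n : ℝ) / (n - s) ≤ Real.exp (2 * s / n) := by
    have hx : (s : ℝ) / n ≤ 1 / 2 := by rw [div_le_iff₀ hn]; linarith
    have hx0 : 0 ≤ (s : ℝ) / n := by positivity
    have h1 : (n : ℝ) - s = n * (1 - s / n) := by field_simp
    have h2 := Real.add_one_le_exp (2 * (s : ℝ) / n)
    have h3 : 2 * (s : ℝ) / n = 2 * (s / n) := by ring
    rw [div_le_iff₀ hns, h1]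
    have h4 : 1 ≤ Real.exp (2 * s / n) * (1 - s / n) := by
      rw [h3] at h2 ⊢
      nlinarith
    nlinarith
  have key := prob_forall_not_le (n := n) (k := k) (fun φ : Fin s ↪ Fin n => IsHeap φ)
    (μ := N * a) (b := b) (by positivity) ?_ hb0 ?_
  · refine key.trans ?_
    have hμ : 1 / (N * a) ≤ 2 / n * Real.exp (2 * k * (k * t + 1)) := by
      have h1 : ((n : ℝ) - s) * (((n : ℝ) - s) / n) ^ (n * k) ≤ N * a := by
        refine le_trans (le_of_eq ?_) (mul_le_mul_of_nonneg_right hNle ha0.le)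
        rw [ha, div_pow, ← mul_div_assoc, ← mul_div_assoc, ← pow_succ', ← pow_add]
        congr 2
        omega
      have h2 : (((n : ℝ) - s) / n) ^ (n * k) = (((n : ℝ) / (n - s)) ^ (n * k))⁻¹ := by
        rw [← inv_pow, inv_div]
      calc 1 / (N * a) ≤ 1 / (((n : ℝ) - s) * (((n : ℝ) - s) / n) ^ (n * k)) := by gcongr
        _ = 1 / ((n : ℝ) - s) * ((n : ℝ) / (n - s)) ^ (n * k) := by
          rw [h2, one_div, mul_inv, inv_inv, one_div]
        _ ≤ 2 / n * Real.exp (2 * s / n) ^ (n * k) := by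
          gcongr ?_ * ?_ ^ _
          rw [div_le_div_iff₀ hns hn]
          linarith
        _ = 2 / n * Real.exp (2 * k * (k * t + 1)) := by
          rw [← Real.exp_nat_mul, ← hs1]
          congr 2
          push_cast
          field_simp
    have hba : N ^ 2 * b / (N * a) ^ 2 ≤ Real.exp (4 * (k * t) * (k * t + 1) / n) := by
      obtain ⟨M, hM⟩ : ∃ M, n * k = M + 2 * (k * t) := ⟨n * k - 2 * (k * t), by omega⟩
      have e1 : n * k - k * t = M + k * t := by omega
      have e2 : n * k - 2 * (k * t) = M := by omega
      have h1 : b ≤ a ^ 2 * ((n : ℝ) / (n - s)) ^ (2 * (k * t)) := by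
        have h3 : a ^ 2 * ((n : ℝ) / (n - s)) ^ (2 * (k * t))
            = (((n : ℝ) - s) * (n - s) / n) ^ M / (n : ℝ) ^ (n * k) := by
          rw [ha, e1, div_pow, div_pow, div_pow, hM, mul_pow]
          field_simp
          ring
        rw [h3, hb, e2]
        gcongr
        rw [le_div_iff₀ hn]
        nlinarith [sq_nonneg (s : ℝ)]
      calc N ^ 2 * b / (N * a) ^ 2 = b / a ^ 2 := by
            rw [mul_pow, mul_div_mul_left _ _ (by positivity)]
        _ ≤ ((n : ℝ) / (n - s)) ^ (2 * (k * t)) := by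
            rw [div_le_iff₀ (by positivity), mul_comm]
            exact h1
        _ ≤ Real.exp (2 * s / n) ^ (2 * (k * t)) := by gcongr
        _ = Real.exp (4 * (k * t) * (k * t + 1) / n) := by
            rw [← Real.exp_nat_mul, ← hs1]
            congr 1
            push_cast
            ring
    linarith
  · refine le_trans (le_of_eq ?_) (Finset.sum_le_sum fun φ _ => le_prob_isHeap hk φ)
    rw [Finset.sum_const, Finset.card_univ, nsmul_eq_mul, ← hN, ← hs, hcast]
  · intro φ ψ hne
    refine (prob_isHeap_and_le hk hne).trans (le_of_eq ?_)
    rw [← hs, hcast2]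
/-! ### The maximal distance -/

lemma pathDist_le {n k : ℕ} {f : Fin n × Fin k → Fin n} {u v : Fin n} {m : ℕ}
    (c : Fin (m + 1) → Fin n) (h0 : c 0 = u) (hl : c (Fin.last m) = v)
    (hc : ∀ j : Fin m, ∃ i : Fin k, f (c j.castSucc, i) = c j.succ) : pathDist f u v ≤ m :=
  sInf_le ⟨m, rfl, c, h0, hl, hc⟩

lemma exists_iSup_iInf_pathDist_eq {n k : ℕ} (hk : 2 ≤ k) {f : Fin n × Fin k → Fin n} {m q : ℕ}
    (hfar : ¬ ∃ (v : Fin n) (S : Finset (Fin n)), S.Nonempty ∧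
      IsClosedSet f (S : Set (Fin n)) ∧ Disjoint S (arcBall f ∅ v (q + 2)))
    {φ : Fin (k * (2 * k ^ m) + 1) ↪ Fin n} (hφ : IsHeap φ f) {G : Set (Fin n)}
    (hcl : IsClosedSet f G) (hsc : IsStrConn f G) :
    ∃ W : ℕ, (⨆ v ∈ Gᶜ, ⨅ u ∈ G, pathDist f v u) = (W : ℕ∞) ∧ m + 1 ≤ W ∧ W ≤ q + 2 := by
  have hle : (⨆ v ∈ Gᶜ, ⨅ u ∈ G, pathDist f v u) ≤ ((q + 2 : ℕ) : ℕ∞) := by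
    refine iSup₂_le fun v _ => ?_
    have : ¬ Disjoint G.toFinset (arcBall f ∅ v (q + 2)) := fun hd =>
      hfar ⟨v, G.toFinset, by simpa using hsc.1, by simpa using hcl, hd⟩
    obtain ⟨u, hu, hu'⟩ := Finset.not_disjoint_iff.1 this
    obtain ⟨l, hl, c, h0, h1, hc⟩ := exists_path_of_mem_arcBall hu'
    refine (iInf₂_le u (by simpa using hu)).trans ((pathDist_le c h0 h1 hc).trans ?_)
    exact_mod_cast hl
  have hge : ((m + 1 : ℕ) : ℕ∞) ≤ ⨆ v ∈ Gᶜ, ⨅ u ∈ G, pathDist f v u := by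
    have hout := hφ.notMem_of_isClosedSet (by omega) hcl hsc
    refine le_trans ?_ (le_iSup₂ (f := fun v (_ : v ∈ Gᶜ) => ⨅ u ∈ G, pathDist f v u)
      (φ 0) (hout 0))
    refine le_iInf₂ fun u hu => le_sInf ?_
    rintro _ ⟨l, rfl, c, h0, h1, hc⟩
    rw [Nat.cast_le]
    by_contra! hlt
    obtain ⟨a, ha⟩ := hφ.walk_mem hk le_rfl (by omega) c h0 hc
    exact hout a (ha ▸ h1 ▸ hu)
  obtain ⟨W, hW⟩ := ENat.ne_top_iff_exists.1 (ne_top_of_le_ne_top (ENat.natCast_ne_top _) hle)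
  rw [← hW] at hle hge
  exact ⟨W, hW.symm, by exact_mod_cast hge, by exact_mod_cast hle⟩

/-! ### Asymptotics -/

lemma tendsto_log_natCast : Tendsto (fun n : ℕ => Real.log n) atTop atTop :=
  Real.tendsto_log_atTop.comp tendsto_natCast_atTop_atTop

lemma tendsto_log_rpow_div (r : ℝ) :
    Tendsto (fun n : ℕ => Real.log n ^ r / (n : ℝ)) atTop (nhds 0) := by
  have h := (isLittleO_log_rpow_rpow_atTop r (zero_lt_one' ℝ)).tendsto_div_nhds_zero
  simpa [Function.comp_def] using h.comp tendsto_natCast_atTop_atTop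

lemma tendsto_exp_two_mul_sub_rpow {c δ : ℝ} (hc : 0 < c) (hδ : 0 < δ) :
    Tendsto (fun y : ℝ => Real.exp (2 * y - c * y ^ (1 + δ))) atTop (nhds 0) := by
  refine Real.tendsto_exp_atBot.comp ?_
  have h1 : Tendsto (fun y : ℝ => y * (2 - c * y ^ δ)) atTop atBot := by
    refine tendsto_id.atTop_mul_atBot₀ ?_
    refine tendsto_atBot_add_const_left atTop 2 (f := fun y : ℝ => -(c * y ^ δ)) ?_
    exact tendsto_neg_atTop_atBot.comp ((tendsto_rpow_atTop hδ).const_mul_atTop hc)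
  refine h1.congr' ?_
  filter_upwards [eventually_gt_atTop 0] with y hy
  rw [Real.rpow_add hy, Real.rpow_one]
  ring

lemma tendsto_exp_rpow_sub {c δ : ℝ} (hδ : 0 < δ) :
    Tendsto (fun y : ℝ => Real.exp (c * y ^ (1 - δ) - y)) atTop (nhds 0) := by
  refine Real.tendsto_exp_atBot.comp ?_
  have h1 : Tendsto (fun y : ℝ => y * (c * y ^ (-δ) - 1)) atTop atBot := by
    have h2 : Tendsto (fun y : ℝ => c * y ^ (-δ) - 1) atTop (nhds (c * 0 - 1)) :=
      ((tendsto_rpow_neg_atTop hδ).const_mul c).sub_const 1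
    exact tendsto_id.atTop_mul_neg (by norm_num) h2
  refine h1.congr' ?_
  filter_upwards [eventually_gt_atTop 0] with y hy
  rw [sub_eq_add_neg (1 : ℝ) δ, Real.rpow_add hy, Real.rpow_one]
  ring

/-- Powers of the base with exponents near multiples of `log_k y`. -/
lemma pow_floor_le_rpow {k b : ℕ} (hb : 1 ≤ b) {y a : ℝ} (hy : 1 ≤ y)
    {j : ℕ} (hj : (j : ℝ) ≤ a * (Real.log y / Real.log k)) :
    (b : ℝ) ^ j ≤ y ^ (a * (Real.log b / Real.log k)) := by
  have hb' : (1 : ℝ) ≤ b := by exact_mod_cast hb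
  have hb0 : (0 : ℝ) < b := by linarith
  rw [← Real.rpow_natCast]
  refine (Real.rpow_le_rpow_of_exponent_le hb' hj).trans (le_of_eq ?_)
  rw [Real.rpow_def_of_pos hb0, Real.rpow_def_of_pos (by linarith)]
  congr 1
  ring

lemma rpow_le_pow_of_le {k : ℕ} (hk : 2 ≤ k) {y a : ℝ} (hy : 1 ≤ y)
    {j : ℕ} (hj : a * (Real.log y / Real.log k) ≤ j) : y ^ a ≤ (k : ℝ) ^ j := by
  have hk' : (1 : ℝ) < k := by exact_mod_cast hk
  have hlog : 0 < Real.log k := Real.log_pos hk'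
  rw [← Real.rpow_natCast]
  refine le_trans (le_of_eq ?_) (Real.rpow_le_rpow_of_exponent_le hk'.le hj)
  rw [Real.rpow_def_of_pos (by linarith), Real.rpow_def_of_pos (by linarith)]
  congr 1
  field_simp

lemma far_bound_le {n k q : ℕ} (hk : 2 ≤ k) {δ : ℝ} (hδ1 : δ ≤ 1)
    (hn : 1 ≤ Real.log n)
    (hq1 : (q : ℝ) + 2 ≤ (1 + δ) * (Real.log (Real.log n) / Real.log k))
    (hq2 : (1 + δ) * (Real.log (Real.log n) / Real.log k) ≤ q + 3) :
    6 / n + n * (k * ((k + 1) ^ (q + 1)) ^ 2 / n) ^ 2 + n ^ 2 * (11 / 12 : ℝ) ^ (k ^ (q + 1))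
      ≤ 6 / n + (k : ℝ) ^ 2 *
          (Real.log n ^ (4 * (2 * (Real.log (k + 1 : ℕ) / Real.log k))) / n)
        + Real.exp (2 * Real.log n
          - (-Real.log (11 / 12) / k ^ 2) * Real.log n ^ (1 + δ)) := by
  have hk' : (1 : ℝ) < k := by exact_mod_cast hk
  have hn0 : (0 : ℝ) < n := by
    by_contra h
    have : (n : ℝ) = 0 := le_antisymm (not_lt.1 h) (Nat.cast_nonneg n)
    rw [this, Real.log_zero] at hn
    linarith
  have hL : 0 ≤ Real.log (Real.log n) / Real.log k :=
    div_nonneg (Real.log_nonneg hn) (Real.log_nonneg hk'.le)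
  set y := Real.log n with hy
  refine add_le_add (add_le_add le_rfl ?_) ?_
  · have h1 := pow_floor_le_rpow (b := k + 1) (j := q + 1) (a := 2) (by omega) hn
      (by push_cast; nlinarith)
    set C := 2 * (Real.log (k + 1 : ℕ) / Real.log k) with hC
    calc (n : ℝ) * (k * (((k : ℝ) + 1) ^ (q + 1)) ^ 2 / n) ^ 2
        = (k : ℝ) ^ 2 * ((((k + 1 : ℕ) : ℝ) ^ (q + 1)) ^ 4 / n) := by
          push_cast
          field_simp
      _ ≤ (k : ℝ) ^ 2 * ((y ^ C) ^ 4 / n) := by gcongr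
      _ = _ := by
          rw [← Real.rpow_natCast (y ^ C), ← Real.rpow_mul (by linarith), mul_comm C]
          norm_num
  · have h1 := rpow_le_pow_of_le (a := 1 + δ) (j := q + 3) hk hn (by push_cast; exact hq2)
    have h2 : y ^ (1 + δ) / (k : ℝ) ^ 2 ≤ ((k ^ (q + 1) : ℕ) : ℝ) := by
      rw [div_le_iff₀ (by positivity)]
      push_cast
      rw [← pow_add]
      exact h1
    have hlog : Real.log (11 / 12) < 0 := Real.log_neg (by norm_num) (by norm_num)
    have h3 : (n : ℝ) ^ 2 = Real.exp (2 * y) := by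
      rw [two_mul, Real.exp_add, hy, Real.exp_log hn0, sq]
    have h4 : (11 / 12 : ℝ) ^ (k ^ (q + 1))
        = Real.exp (Real.log (11 / 12) * ((k ^ (q + 1) : ℕ) : ℝ)) := by
      rw [← Real.rpow_natCast, Real.rpow_def_of_pos (by norm_num)]
    rw [h3, h4, ← Real.exp_add]
    gcongr
    have h5 := mul_le_mul_of_nonpos_left h2 hlog.le
    have h6 : -Real.log (11 / 12) / (k : ℝ) ^ 2 * y ^ (1 + δ)
        = -(Real.log (11 / 12) * (y ^ (1 + δ) / (k : ℝ) ^ 2)) := by ring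
    rw [h6]
    linarith

lemma heap_bound_le {n k m : ℕ} (hk : 2 ≤ k) {δ : ℝ} (hδ0 : 0 ≤ δ)
    (hn : 1 ≤ Real.log n)
    (hm : (m : ℝ) ≤ (1 - δ) * (Real.log (Real.log n) / Real.log k)) :
    2 * (((k * (2 * k ^ m) + 1 : ℕ)) : ℝ) ≤ 8 * k * Real.log n ∧
    2 / n * Real.exp (2 * k * (k * (2 * k ^ m : ℕ) + 1))
        + (Real.exp (4 * (k * (2 * k ^ m : ℕ)) * (k * (2 * k ^ m : ℕ) + 1) / n) - 1)
      ≤ 2 * Real.exp (8 * k ^ 2 * Real.log n ^ (1 - δ) - Real.log n)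
        + (Real.exp (64 * k ^ 2 * (Real.log n ^ (2 : ℝ) / n)) - 1) := by
  have hk' : (1 : ℝ) < k := by exact_mod_cast hk
  have hn0 : (0 : ℝ) < n := by
    by_contra h
    have : (n : ℝ) = 0 := le_antisymm (not_lt.1 h) (Nat.cast_nonneg n)
    rw [this, Real.log_zero] at hn
    linarith
  have hlogk : Real.log k ≠ 0 := (Real.log_pos hk').ne'
  have h1 := pow_floor_le_rpow (b := k) (j := m) (by omega) hn hm
  rw [div_self hlogk, mul_one] at h1
  set y := Real.log n with hy
  have h2 : y ^ (1 - δ) ≤ y := by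
    calc y ^ (1 - δ) ≤ y ^ (1 : ℝ) := Real.rpow_le_rpow_of_exponent_le hn (by linarith)
      _ = y := Real.rpow_one y
  have hx1 : (1 : ℝ) ≤ (k : ℝ) ^ m := one_le_pow₀ hk'.le
  have hk1 : (1 : ℝ) ≤ k * (2 * (k : ℝ) ^ m) := by nlinarith
  push_cast
  set x := (k : ℝ) ^ m with hx
  have h3 : k * (2 * x) + 1 ≤ 4 * k * x := by linarith
  refine ⟨?_, ?_⟩
  · have : (k : ℝ) * x ≤ k * y := by gcongr; exact h1.trans h2
    linarith
  · gcongr ?_ + (Real.exp ?_ - 1)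
    · rw [sub_eq_add_neg, Real.exp_add, Real.exp_neg, hy, Real.exp_log hn0, ← hy]
      have : 2 * k * (k * (2 * x) + 1) ≤ 8 * k ^ 2 * y ^ (1 - δ) := by
        calc 2 * k * (k * (2 * x) + 1) ≤ 2 * k * (4 * k * x) := by gcongr
          _ = 8 * k ^ 2 * x := by ring
          _ ≤ _ := by gcongr
      calc 2 / n * Real.exp (2 * k * (k * (2 * x) + 1))
          ≤ 2 / n * Real.exp (8 * k ^ 2 * y ^ (1 - δ)) := by gcongr
        _ = _ := by ring
    · rw [Real.rpow_two, ← mul_div_assoc]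
      refine div_le_div_of_nonneg_right ?_ hn0.le
      have h4 : k * (2 * x) ≤ 4 * k * x := by linarith
      calc 4 * (k * (2 * x)) * (k * (2 * x) + 1) ≤ 4 * (4 * k * x) * (4 * k * x) :=
            mul_le_mul (by linarith) h3 (by positivity) (by positivity)
        _ = 64 * k ^ 2 * x ^ 2 := by ring
        _ ≤ 64 * k ^ 2 * y ^ 2 := by gcongr; exact h1.trans h2

lemma tendsto_error_bound {k : ℕ} (hk : 2 ≤ k) {δ : ℝ} (hδ : 0 < δ) :
    Tendsto (fun n : ℕ => (6 / (n : ℝ) + (k : ℝ) ^ 2 *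
          (Real.log n ^ (4 * (2 * (Real.log (k + 1 : ℕ) / Real.log k))) / n)
        + Real.exp (2 * Real.log n
          - (-Real.log (11 / 12) / k ^ 2) * Real.log n ^ (1 + δ)))
      + (2 * Real.exp (8 * k ^ 2 * Real.log n ^ (1 - δ) - Real.log n)
        + (Real.exp (64 * k ^ 2 * (Real.log n ^ (2 : ℝ) / n)) - 1))) atTop (nhds 0) := by
  have hc : 0 < -Real.log (11 / 12) / (k : ℝ) ^ 2 := by
    have hlog : Real.log (11 / 12) < 0 := Real.log_neg (by norm_num) (by norm_num)
    exact div_pos (by linarith) (by positivity)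
  have h1 : Tendsto (fun n : ℕ => 6 / (n : ℝ)) atTop (nhds 0) :=
    tendsto_const_div_atTop_nhds_zero_nat 6
  have h2 := (tendsto_log_rpow_div
    (4 * (2 * (Real.log (k + 1 : ℕ) / Real.log k)))).const_mul ((k : ℝ) ^ 2)
  have h3 := (tendsto_exp_two_mul_sub_rpow hc hδ).comp tendsto_log_natCast
  have h4 := ((tendsto_exp_rpow_sub (c := 8 * (k : ℝ) ^ 2) hδ).comp
    tendsto_log_natCast).const_mul 2
  have h5 := ((Real.continuous_exp.tendsto _).comp
    ((tendsto_log_rpow_div 2).const_mul (64 * (k : ℝ) ^ 2))).sub_const 1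
  have := ((h1.add h2).add h3).add (h4.add h5)
  simpa [Function.comp_def] using this

/-- The maximum distance `W_n = max_{v ∉ 𝒢} min_{u ∈ 𝒢} dist(v,u)` to the giant satisfies
`W_n / log_k log n → 1` in probability (the event `W_n = ∞` counts as deviant). -/
theorem max_distance_to_giant (k : ℕ) (hk : 2 ≤ k) (ε : ℝ) (hε : 0 < ε) :
    Filter.Tendsto (fun n : ℕ =>
      prob n k (fun f => ∃ G : Set (Fin n), IsGiant f G ∧
        ∀ W : ℕ, (⨆ v ∈ Gᶜ, ⨅ u ∈ G, pathDist f v u) = (W : ℕ∞) →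
          ε < |(W : ℝ) / (Real.log (Real.log n) / Real.log k) - 1|))
      Filter.atTop (nhds 0) := by
  set δ := min ε (1 / 2) with hδdef
  have hδ : 0 < δ := lt_min hε (by norm_num)
  have hδε : δ ≤ ε := min_le_left _ _
  have hδ1 : δ ≤ 1 / 2 := min_le_right _ _
  have hk' : (1 : ℝ) < k := by exact_mod_cast hk
  have hlogk : 0 < Real.log k := Real.log_pos hk'
  have hL : Tendsto (fun n : ℕ => Real.log (Real.log n) / Real.log k) atTop atTop :=
    (Real.tendsto_log_atTop.comp tendsto_log_natCast).atTop_div_const hlogk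
  have hsmall : ∀ᶠ n : ℕ in atTop, 8 * k * Real.log n ≤ n := by
    have h := (tendsto_log_rpow_div 1).const_mul (8 * (k : ℝ))
    rw [mul_zero] at h
    filter_upwards [h.eventually_lt_const zero_lt_one, eventually_gt_atTop 0] with n hn hn0
    have hn0' : (0 : ℝ) < n := by exact_mod_cast hn0
    rw [Real.rpow_one, ← mul_div_assoc, div_lt_one hn0'] at hn
    exact hn.le
  refine squeeze_zero' (Eventually.of_forall fun n => prob_nonneg _) ?_ (tendsto_error_bound hk hδ)
  filter_upwards [hL.eventually_ge_atTop 2, tendsto_log_natCast.eventually_ge_atTop 1, hsmall,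
    eventually_gt_atTop 0] with n hLn hlogn hn8 hn0
  have : NeZero n := ⟨hn0.ne'⟩
  set L := Real.log (Real.log n) / Real.log k with hLdef
  obtain ⟨q, hq⟩ : ∃ q, ⌊(1 + δ) * L⌋₊ = q + 2 := by
    have : 2 ≤ ⌊(1 + δ) * L⌋₊ := Nat.le_floor (by push_cast; nlinarith)
    exact ⟨_, (Nat.sub_add_cancel this).symm⟩
  have hq1 : (q : ℝ) + 2 ≤ (1 + δ) * L := by
    have := Nat.floor_le (a := (1 + δ) * L) (by nlinarith)
    rw [hq] at this
    exact_mod_cast this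
  have hq2 : (1 + δ) * L ≤ q + 3 := by
    have := (Nat.lt_floor_add_one ((1 + δ) * L)).le
    rw [hq] at this
    push_cast at this
    linarith
  set m := ⌊(1 - δ) * L⌋₊ with hm
  have hm1 : (m : ℝ) ≤ (1 - δ) * L := Nat.floor_le (by nlinarith)
  have hm2 : (1 - δ) * L ≤ m + 1 := (Nat.lt_floor_add_one _).le
  obtain ⟨hsize, hheap⟩ := heap_bound_le hk hδ.le hlogn hm1
  have hsize' : 2 * (k * (2 * k ^ m) + 1) ≤ n := by exact_mod_cast hsize.trans hn8
  refine le_trans (prob_mono (Q := fun f => (∃ (v : Fin n) (S : Finset (Fin n)), S.Nonempty ∧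
      IsClosedSet f (S : Set (Fin n)) ∧ Disjoint S (arcBall f ∅ v (q + 2))) ∨
      ∀ φ : Fin (k * (2 * k ^ m) + 1) ↪ Fin n, ¬ IsHeap φ f) ?_)
    ((prob_or_le _ _).trans (add_le_add
      ((prob_exists_far_isClosedSet_le hk q).trans
        (far_bound_le hk (by linarith) hlogn hq1 hq2))
      ((prob_forall_not_isHeap_le (by omega) hsize').trans hheap)))
  rintro f ⟨G, ⟨hcl, hsc, -⟩, hG⟩
  by_contra! hcon
  obtain ⟨hfar, φ, hφ⟩ := hcon
  obtain ⟨W, hW, hmW, hWq⟩ :=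
    exists_iSup_iInf_pathDist_eq hk (by push Not; exact hfar) hφ hcl hsc
  refine absurd (hG W hW) (not_lt.2 ?_)
  have hmW' : (m : ℝ) + 1 ≤ W := by exact_mod_cast hmW
  have hWq' : (W : ℝ) ≤ q + 2 := by exact_mod_cast hWq
  have hLpos : 0 < L := by linarith
  refine le_trans ?_ hδε
  have h1 : 1 - δ ≤ W / L := by
    rw [le_div_iff₀ hLpos]
    linarith
  have h2 : W / L ≤ 1 + δ := by
    rw [div_le_iff₀ hLpos]
    linarith
  rw [abs_le]
  constructor <;> linarith
end

section
/- Fix an integer k ≥ 2. In the random k-out digraph 𝒟_{n,k}, let M_n be the length (number of arcs) of the longest directed path all of whose vertices are distinct and lie outside the giant 𝒢. Then M_n / log n converges in probability to 1/log(e^{τ_k}/k): for every ε > 0, P(|M_n/log n − 1/log(e^{τ_k}/k)| > ε) → 0 as n → ∞. -/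
open scoped Classical
open Filter MeasureTheory

/-- There is a directed path of length `ℓ` (with `ℓ+1` distinct vertices)
all of whose vertices lie in `A`. -/
def HasPathIn {n k : ℕ} (f : Fin n × Fin k → Fin n) (A : Set (Fin n)) (ℓ : ℕ) : Prop :=
  ∃ c : Fin (ℓ + 1) → Fin n, Function.Injective c ∧ (∀ j, c j ∈ A) ∧
    ∀ j : Fin ℓ, ∃ i : Fin k, f (c j.castSucc, i) = c j.succ

/-- The number of points of a finite type satisfying a predicate, as a real number. -/
noncomputable def num {Ω : Type*} [Fintype Ω] (P : Ω → Prop) : ℝ :=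
  ((Finset.univ.filter P).card : ℝ)

section Counting

variable {Ω : Type*} [Fintype Ω]

theorem num_nonneg (P : Ω → Prop) : 0 ≤ num P := Nat.cast_nonneg _

theorem num_mono {P Q : Ω → Prop} (h : ∀ f, P f → Q f) : num P ≤ num Q := by
  unfold num
  exact_mod_cast Finset.card_le_card (Finset.monotone_filter_right _ fun f _ => h f)

theorem num_congr {P Q : Ω → Prop} (h : ∀ f, P f ↔ Q f) : num P = num Q :=
  le_antisymm (num_mono fun f => (h f).1) (num_mono fun f => (h f).2)

theorem num_eq_sum (P : Ω → Prop) : num P = ∑ f, if P f then (1 : ℝ) else 0 := by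
  simp [num]

theorem num_true : num (fun _ : Ω => True) = Fintype.card Ω := by
  simp [num]

theorem num_eq_zero {P : Ω → Prop} (h : ∀ f, ¬ P f) : num P = 0 := by
  simp [num_eq_sum, h]

theorem num_exists_le {ι : Type*} (s : Finset ι) (P : ι → Ω → Prop) :
    num (fun f => ∃ i ∈ s, P i f) ≤ ∑ i ∈ s, num (P i) := by
  simp only [num_eq_sum]
  rw [Finset.sum_comm]
  refine Finset.sum_le_sum fun f _ => ?_
  split_ifs with h
  · obtain ⟨i, hi, hP⟩ := h
    calc (1 : ℝ) = if P i f then 1 else 0 := by simp [hP]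
      _ ≤ _ := Finset.single_le_sum (f := fun i => if P i f then (1 : ℝ) else 0)
        (fun j _ => by split_ifs <;> norm_num) hi
  · exact Finset.sum_nonneg fun j _ => by split_ifs <;> norm_num

theorem num_or_le (P Q : Ω → Prop) : num (fun f => P f ∨ Q f) ≤ num P + num Q := by
  simp only [num_eq_sum, ← Finset.sum_add_distrib]
  refine Finset.sum_le_sum fun f _ => ?_
  by_cases hP : P f <;> by_cases hQ : Q f <;> simp [hP, hQ]

theorem num_and_add_num_and_not (P Q : Ω → Prop) :
    num (fun f => P f ∧ Q f) + num (fun f => P f ∧ ¬ Q f) = num P := by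
  simp only [num_eq_sum, ← Finset.sum_add_distrib]
  refine Finset.sum_congr rfl fun f _ => ?_
  by_cases hP : P f <;> by_cases hQ : Q f <;> simp [hP, hQ]

theorem sum_num_le_card {ι : Type*} (s : Finset ι) (P : ι → Ω → Prop)
    (h : ∀ f, ∀ i ∈ s, ∀ j ∈ s, P i f → P j f → i = j) :
    ∑ i ∈ s, num (P i) ≤ Fintype.card Ω := by
  simp only [num_eq_sum]
  rw [Finset.sum_comm, ← Finset.card_univ, ← nsmul_one, ← Finset.sum_const]
  refine Finset.sum_le_sum fun f _ => ?_
  rw [← Finset.sum_filter, Finset.sum_const, nsmul_one]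
  have : (s.filter fun i => P i f).card ≤ 1 := Finset.card_le_one.2 fun i hi j hj =>
    h f i (Finset.mem_filter.1 hi).1 j (Finset.mem_filter.1 hj).1
      (Finset.mem_filter.1 hi).2 (Finset.mem_filter.1 hj).2
  exact_mod_cast this

end Counting

section Prescribing

variable {ι V J : Type*} [Fintype ι] [DecidableEq ι] [Fintype V]

theorem num_and_eq_at (A : (ι → V) → Prop) (x : ι) (v : V)
    (hA : ∀ f f', (∀ y, y ≠ x → f y = f' y) → A f → A f') :
    num (fun f => A f ∧ f x = v) * Fintype.card V = num A := by
  have h1 : ∀ v w, num (fun f => A f ∧ f x = w) ≤ num (fun f => A f ∧ f x = v) := by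
    intro v w
    unfold num
    norm_cast
    refine Finset.card_le_card_of_injOn (fun f => Function.update f x v) ?_ ?_
    · intro f hf
      simp only [Finset.coe_filter, Finset.mem_univ, true_and, Set.mem_ofPred_eq] at hf ⊢
      exact ⟨hA f _ (fun y hy => by simp [hy]) hf.1, by simp⟩
    · intro f hf g hg hfg
      simp only [Finset.coe_filter, Finset.mem_univ, true_and, Set.mem_ofPred_eq] at hf hg
      funext y
      by_cases hy : y = x
      · rw [hy, hf.2, hg.2]
      · simpa [hy] using congrFun hfg y
  have h2 : num A = ∑ w, num (fun f => A f ∧ f x = w) := by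
    simp only [num_eq_sum]
    rw [Finset.sum_comm]
    refine Finset.sum_congr rfl fun f _ => ?_
    by_cases h : A f <;> simp [h]
  rw [h2, Finset.sum_congr rfl fun w _ => le_antisymm (h1 v w) (h1 w v), Finset.sum_const,
    Finset.card_univ, nsmul_eq_mul, mul_comm]

/-- Prescribing the values of a uniformly random function at distinct points which do not
influence the event `A` costs a factor `card V` per point. -/
theorem num_and_prescribed (key : J → ι) (val : J → V) (s : Finset J)
    (hs : Set.InjOn key s) (A : (ι → V) → Prop)
    (hA : ∀ f f', (∀ x, (∀ j ∈ s, key j ≠ x) → f x = f' x) → A f → A f') :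
    num (fun f => A f ∧ ∀ j ∈ s, f (key j) = val j) * (Fintype.card V : ℝ) ^ s.card =
      num A := by
  induction s using Finset.induction_on with
  | empty => simp
  | insert a s ha ih =>
    rw [← ih (hs.mono (by simp)) fun f f' hff hf =>
      hA f f' (fun x hx => hff x fun j hj => hx j (Finset.mem_insert_of_mem hj)) hf,
      Finset.card_insert_of_notMem ha, pow_succ', ← mul_assoc,
      ← num_and_eq_at (fun f => A f ∧ ∀ j ∈ s, f (key j) = val j) (key a) (val a)]
    · congr 2
      refine num_congr fun f => ?_
      simp only [Finset.forall_mem_insert]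
      tauto
    · rintro f f' hff ⟨hf, hfs⟩
      refine ⟨hA f f' (fun x hx => hff x (hx a (Finset.mem_insert_self _ _)).symm) hf,
        fun j hj => ?_⟩
      rw [← hff, hfs j hj]
      intro h
      have := hs (by simp [hj]) (by simp) h
      exact ha (this ▸ hj)

end Prescribing

section Transfer

variable {U : Type*} [Fintype U]

/-- The total weight of the walks with `t` steps from a vertex, for the step weights `M`. -/
noncomputable def walkWeight (M : U → U → ℝ) : ℕ → U → ℝ
  | 0, _ => 1
  | t + 1, u => ∑ v, M u v * walkWeight M t v

theorem sum_prod_eq_walkWeight (M : U → U → ℝ) (t : ℕ) (φ : U → ℝ) :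
    ∑ c : Fin (t + 1) → U, φ (c 0) * ∏ j : Fin t, M (c j.castSucc) (c j.succ) =
      ∑ u, φ u * walkWeight M t u := by
  induction t generalizing φ with
  | zero =>
    simp only [Finset.univ_eq_empty, Finset.prod_empty, walkWeight]
    exact Fintype.sum_equiv (Equiv.funUnique (Fin 1) U) _ _ fun c => by simp
  | succ t ih =>
    rw [← Fintype.sum_equiv (Fin.consEquiv fun _ : Fin (t + 1 + 1) => U)
      (fun p => φ p.1 * (M p.1 (p.2 0) * ∏ j : Fin t, M (p.2 j.castSucc) (p.2 j.succ))) _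
      fun p => by
        rw [Fin.prod_univ_succ]
        simp [Fin.consEquiv]]
    rw [Fintype.sum_prod_type]
    refine Finset.sum_congr rfl fun u _ => ?_
    dsimp only
    rw [← Finset.mul_sum, ih (M u)]
    rfl

/-- A walk which makes uniform steps of weight `a`, plus the steps of a fixed path. -/
noncomputable def pathMatrix (a : ℝ) {ℓ : ℕ} (c : Fin (ℓ + 1) → U) (u v : U) : ℝ :=
  a + if ∃ j : Fin ℓ, c j.castSucc = u ∧ c j.succ = v then 1 else 0

theorem sum_path_step_le {ℓ : ℕ} {c : Fin (ℓ + 1) → U} (hc : Function.Injective c)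
    {x : U → ℝ} {b : ℝ} (hx : ∀ v, x v ≤ b) (u : U) :
    ∑ v, (if ∃ j : Fin ℓ, c j.castSucc = u ∧ c j.succ = v then (1 : ℝ) else 0) * x v ≤
      if ∃ j : Fin ℓ, c j.castSucc = u then b else 0 := by
  split_ifs with h
  · obtain ⟨j, rfl⟩ := h
    have : ∀ v, (∃ j' : Fin ℓ, c j'.castSucc = c j.castSucc ∧ c j'.succ = v) ↔
        v = c j.succ := by
      intro v
      constructor
      · rintro ⟨j', h1, rfl⟩
        rw [Fin.castSucc_injective _ (hc h1)]
      · rintro rfl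
        exact ⟨j, rfl, rfl⟩
    simp only [this]
    simpa using hx _
  · refine le_of_eq (Finset.sum_eq_zero fun v _ => ?_)
    rw [if_neg, zero_mul]
    rintro ⟨j, hj, -⟩
    exact h ⟨j, hj⟩

theorem sum_ite_mem_path_le {ℓ : ℕ} (c : Fin (ℓ + 1) → U) {b : ℝ} (hb : 0 ≤ b) :
    ∑ u, (if ∃ j : Fin ℓ, c j.castSucc = u then b else 0) ≤ ℓ * b := by
  rw [← Finset.sum_filter, Finset.sum_const, nsmul_eq_mul]
  refine mul_le_mul_of_nonneg_right ?_ hb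
  norm_cast
  calc _ ≤ (Finset.univ.image fun j : Fin ℓ => c j.castSucc).card :=
        Finset.card_le_card fun u hu => by simpa using hu
    _ ≤ ℓ := Finset.card_image_le.trans (by simp)

theorem walkWeight_pathMatrix_le {ℓ : ℕ} {c : Fin (ℓ + 1) → U} (hc : Function.Injective c)
    {a n κ : ℝ} (ha : 0 ≤ a) (hκ : 0 ≤ κ) (han : a * n = κ)
    (hm : (Fintype.card U : ℝ) ≤ n) (haU : a * Fintype.card U ≤ 1)
    (hℓ : (ℓ : ℝ) * (ℓ * (1 + 2 * κ * ℓ)) ≤ n) (t : ℕ) (ht : t ≤ ℓ) :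
    (∑ u, walkWeight (pathMatrix a c) t u ≤
        Fintype.card U * (a * Fintype.card U) ^ t + t * (ℓ * (1 + 2 * κ * ℓ))) ∧
      ∀ u, walkWeight (pathMatrix a c) t u ≤ 1 + 2 * κ * t := by
  have hM : ∀ u v, 0 ≤ pathMatrix a c u v := fun u v => by
    unfold pathMatrix
    split_ifs <;> linarith
  have hU : (0 : ℝ) ≤ Fintype.card U := Nat.cast_nonneg _
  induction t with
  | zero => simp [walkWeight]
  | succ t ih =>
    obtain ⟨ih1, ih2⟩ := ih (by omega)
    have htℓ : (t : ℝ) ≤ ℓ := by exact_mod_cast (by omega : t ≤ ℓ)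
    have ht0 : (0 : ℝ) ≤ t := Nat.cast_nonneg _
    have hb : 0 ≤ 1 + 2 * κ * (t : ℝ) := by positivity
    have hstep : ∀ u, walkWeight (pathMatrix a c) (t + 1) u ≤
        a * ∑ v, walkWeight (pathMatrix a c) t v +
          if ∃ j : Fin ℓ, c j.castSucc = u then 1 + 2 * κ * (t : ℝ) else 0 := by
      intro u
      have := sum_path_step_le hc ih2 u
      calc walkWeight (pathMatrix a c) (t + 1) u =
          a * ∑ v, walkWeight (pathMatrix a c) t v + ∑ v,
            (if ∃ j : Fin ℓ, c j.castSucc = u ∧ c j.succ = v then (1 : ℝ) else 0) *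
              walkWeight (pathMatrix a c) t v := by
            rw [Finset.mul_sum, ← Finset.sum_add_distrib]
            refine Finset.sum_congr rfl fun v _ => ?_
            rw [← add_mul]
            rfl
        _ ≤ _ := by linarith
    have hbℓ : 1 + 2 * κ * (t : ℝ) ≤ 1 + 2 * κ * ℓ := by gcongr
    constructor
    · calc ∑ u, walkWeight (pathMatrix a c) (t + 1) u
          ≤ ∑ u, (a * ∑ v, walkWeight (pathMatrix a c) t v +
            if ∃ j : Fin ℓ, c j.castSucc = u then 1 + 2 * κ * (t : ℝ) else 0) :=
            Finset.sum_le_sum fun u _ => hstep u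
        _ ≤ Fintype.card U * a * ∑ v, walkWeight (pathMatrix a c) t v +
            ℓ * (1 + 2 * κ * ℓ) := by
            rw [Finset.sum_add_distrib, Finset.sum_const, Finset.card_univ, nsmul_eq_mul,
              ← mul_assoc]
            gcongr
            exact (sum_ite_mem_path_le c hb).trans (by gcongr)
        _ ≤ Fintype.card U * a * (Fintype.card U * (a * Fintype.card U) ^ t) +
            1 * (t * (ℓ * (1 + 2 * κ * ℓ))) + ℓ * (1 + 2 * κ * ℓ) := by
            have h1 : Fintype.card U * a * ∑ v, walkWeight (pathMatrix a c) t v ≤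
              Fintype.card U * a * (Fintype.card U * (a * Fintype.card U) ^ t +
                t * (ℓ * (1 + 2 * κ * ℓ))) := by gcongr
            have h2 : Fintype.card U * a * (t * (ℓ * (1 + 2 * κ * ℓ))) ≤
              1 * (t * (ℓ * (1 + 2 * κ * ℓ))) := by
              apply mul_le_mul_of_nonneg_right _ (by positivity)
              linarith
            linarith
        _ = _ := by push_cast; ring
    · intro u
      have h1 : ∑ v, walkWeight (pathMatrix a c) t v ≤ 2 * n := by
        have h2 : Fintype.card U * (a * Fintype.card U) ^ t ≤ Fintype.card U * 1 := by
          gcongr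
          exact pow_le_one₀ (by positivity) haU
        have h3 : t * (ℓ * (1 + 2 * κ * ℓ)) ≤ ℓ * (ℓ * (1 + 2 * κ * ℓ)) := by gcongr
        linarith
      have h4 : a * ∑ v, walkWeight (pathMatrix a c) t v ≤ 2 * κ := by
        calc _ ≤ a * (2 * n) := by gcongr
          _ = 2 * κ := by rw [← han]; ring
      have h5 := hstep u
      have h6 : (if ∃ j : Fin ℓ, c j.castSucc = u then 1 + 2 * κ * (t : ℝ) else 0) ≤
          1 + 2 * κ * (t : ℝ) := by split_ifs <;> linarith
      push_cast
      linarith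

end Transfer

section Paths

variable {n k ℓ : ℕ} {T : Finset (Fin n)}

/-- A candidate for a path with `ℓ` arcs in `T`: its vertices and the labels of its arcs. -/
abbrev LabeledPath (k : ℕ) (T : Finset (Fin n)) (ℓ : ℕ) : Type :=
  (Fin (ℓ + 1) ↪ T) × (Fin ℓ → Fin k)

/-- The arcs which the path `p` uses. -/
def LabeledPath.key (p : LabeledPath k T ℓ) (j : Fin ℓ) : Fin n × Fin k :=
  (p.1 j.castSucc, p.2 j)

/-- The targets of the arcs which the path `p` uses. -/
def LabeledPath.target (p : LabeledPath k T ℓ) (j : Fin ℓ) : Fin n :=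
  p.1 j.succ

/-- The candidate `p` is a path of the digraph `f`. -/
def LabeledPath.Present (p : LabeledPath k T ℓ) (f : Fin n × Fin k → Fin n) : Prop :=
  ∀ j, f (p.key j) = p.target j

/-- The event `A` does not depend on the arcs which start in `T`. -/
def IndepOfArcs (T : Finset (Fin n)) (A : (Fin n × Fin k → Fin n) → Prop) : Prop :=
  ∀ f f', (∀ v ∉ T, ∀ i, f (v, i) = f' (v, i)) → A f → A f'

theorem LabeledPath.key_injective (p : LabeledPath k T ℓ) : Function.Injective p.key := by
  intro j j' h
  have := p.1.injective (Subtype.ext (Prod.ext_iff.1 h).1)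
  exact Fin.castSucc_injective _ this

theorem LabeledPath.mem_of_key_eq (p : LabeledPath k T ℓ) {j : Fin ℓ} {v : Fin n} {i : Fin k}
    (h : p.key j = (v, i)) : v ∈ T := by
  have hv : (p.1 j.castSucc : Fin n) = v := (Prod.ext_iff.1 h).1
  exact hv ▸ (p.1 j.castSucc).2

theorem hasPathIn_iff {f : Fin n × Fin k → Fin n} :
    HasPathIn f T ℓ ↔ ∃ p : LabeledPath k T ℓ, p.Present f := by
  constructor
  · rintro ⟨c, hc, hT, hf⟩
    choose i hi using hf
    exact ⟨(⟨fun j => ⟨c j, hT j⟩, fun j j' h => hc (by simpa using h)⟩, i), hi⟩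
  · rintro ⟨p, hp⟩
    exact ⟨fun j => p.1 j, Subtype.val_injective.comp p.1.injective, fun j => (p.1 j).2,
      fun j => ⟨p.2 j, hp j⟩⟩

variable {A : (Fin n × Fin k → Fin n) → Prop}

theorem num_and_present (hA : IndepOfArcs T A) (p : LabeledPath k T ℓ) :
    num (fun f => A f ∧ p.Present f) * (n : ℝ) ^ ℓ = num A := by
  have := num_and_prescribed p.key p.target Finset.univ p.key_injective.injOn A
    fun f f' hff hf => hA f f' (fun v hv i => hff _ fun j _ h => hv ?_) hf
  · simpa [LabeledPath.Present] using this
  · exact p.mem_of_key_eq h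

/-- The probability that the arc `x` has the target `v`, given that the path `p` is present, is
at most this weight. -/
noncomputable def arcWeight (p : LabeledPath k T ℓ) (x : Fin n × Fin k) (v : Fin n) : ℝ :=
  1 / n + if ∃ j, p.key j = x ∧ p.target j = v then 1 else 0

theorem num_present_present_le (hA : IndepOfArcs T A) (p q : LabeledPath k T ℓ) :
    num (fun f => (A f ∧ p.Present f) ∧ q.Present f) ≤
      num (fun f => A f ∧ p.Present f) * ∏ j, arcWeight p (q.key j) (q.target j) := by
  have hw : ∀ x v, 0 ≤ arcWeight p x v := fun x v => by
    unfold arcWeight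
    split_ifs <;> positivity
  by_cases hcompat : ∀ j, ∀ j', p.key j' = q.key j → p.target j' = q.target j
  · set s : Finset (Fin ℓ) := Finset.univ.filter fun j => ¬ ∃ j', p.key j' = q.key j with hs
    have h1 := num_and_prescribed q.key q.target s q.key_injective.injOn
      (fun f => A f ∧ p.Present f) ?_
    · have hn : 0 < (n : ℝ) ∨ s.card = 0 := by
        rcases Nat.eq_zero_or_pos n with h | h
        · subst h
          right
          rw [Finset.card_eq_zero, Finset.eq_empty_iff_forall_notMem]
          intro j
          exact (q.target j).elim0
        · left
          exact_mod_cast h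
      have hpos : 0 < (n : ℝ) ^ s.card := by
        rcases hn with h | h
        · positivity
        · rw [h]; norm_num
      have h2 : ((n : ℝ) ^ s.card)⁻¹ ≤ ∏ j, arcWeight p (q.key j) (q.target j) := by
        calc ((n : ℝ) ^ s.card)⁻¹ = ∏ j, if j ∈ s then (1 / n : ℝ) else 1 := by
              rw [Finset.prod_ite_mem, Finset.univ_inter, Finset.prod_const, one_div, inv_pow]
          _ ≤ _ := by
            refine Finset.prod_le_prod (fun j _ => by split_ifs <;> positivity) fun j _ => ?_
            unfold arcWeight
            split_ifs with h3 h4 h4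
            · linarith
            · linarith
            · have : (0 : ℝ) ≤ 1 / n := by positivity
              linarith
            · exfalso
              simp only [hs, Finset.mem_filter, Finset.mem_univ, true_and, not_not] at h3
              obtain ⟨j', hj'⟩ := h3
              exact h4 ⟨j', hj', hcompat _ _ hj'⟩
      calc num (fun f => (A f ∧ p.Present f) ∧ q.Present f)
          ≤ num (fun f => (A f ∧ p.Present f) ∧ ∀ j ∈ s, f (q.key j) = q.target j) :=
            num_mono fun f hf => ⟨hf.1, fun j _ => hf.2 j⟩
        _ = num (fun f => A f ∧ p.Present f) * ((n : ℝ) ^ s.card)⁻¹ := by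
            rw [← h1, Fintype.card_fin]
            field_simp
        _ ≤ _ := mul_le_mul_of_nonneg_left h2 (num_nonneg _)
    · rintro f f' hff ⟨hf, hp⟩
      refine ⟨hA f f' (fun v hv i => hff _ fun j _ h => hv ?_) hf, fun j => ?_⟩
      · exact q.mem_of_key_eq h
      · rw [← hff, hp j]
        intro j' hj' h
        simp only [hs, Finset.mem_filter, Finset.mem_univ, true_and] at hj'
        exact hj' ⟨j, h.symm⟩
  · rw [num_eq_zero]
    · exact mul_nonneg (num_nonneg _) (Finset.prod_nonneg fun j _ => hw _ _)
    · rintro f ⟨⟨-, hp⟩, hq⟩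
      push Not at hcompat
      obtain ⟨j, j', h1, h2⟩ := hcompat
      exact h2 (by rw [← hp j', h1, hq j])

theorem sum_arcWeight_le (p : LabeledPath k T ℓ) (u v : T) :
    ∑ i, arcWeight p ((u : Fin n), i) v ≤ pathMatrix ((k : ℝ) / n) p.1 u v := by
  unfold arcWeight pathMatrix
  rw [Finset.sum_add_distrib, Finset.sum_const, Finset.card_univ, Fintype.card_fin,
    nsmul_eq_mul, mul_one_div]
  gcongr
  split_ifs with h
  · obtain ⟨j, rfl, rfl⟩ := h
    calc _ ≤ ∑ i, if i = p.2 j then (1 : ℝ) else 0 := by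
          refine Finset.sum_le_sum fun i _ => ?_
          split_ifs with h1 h2 h2 <;> try norm_num
          obtain ⟨j', hj', -⟩ := h1
          obtain ⟨h3, h4⟩ := Prod.ext_iff.1 hj'
          have := Fin.castSucc_injective _ (p.1.injective (Subtype.ext h3))
          subst this
          exact h2 h4.symm
      _ = 1 := by simp
  · refine le_of_eq (Finset.sum_eq_zero fun i _ => ?_)
    rw [if_neg]
    rintro ⟨j, h1, h2⟩
    exact h ⟨j, Subtype.ext (Prod.ext_iff.1 h1).1, Subtype.ext h2⟩

theorem sum_prod_arcWeight_le (p : LabeledPath k T ℓ) :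
    ∑ q : LabeledPath k T ℓ, ∏ j, arcWeight p (q.key j) (q.target j) ≤
      ∑ u, walkWeight (pathMatrix ((k : ℝ) / n) p.1) ℓ u := by
  have hw : ∀ x v, 0 ≤ arcWeight p x v := fun x v => by
    unfold arcWeight
    split_ifs <;> positivity
  have hM : ∀ u v, 0 ≤ pathMatrix ((k : ℝ) / n) p.1 u v := fun u v => by
    unfold pathMatrix
    split_ifs <;> positivity
  rw [Fintype.sum_prod_type]
  calc ∑ c : Fin (ℓ + 1) ↪ T, ∑ i : Fin ℓ → Fin k,
        ∏ j, arcWeight p (((c j.castSucc : T) : Fin n), i j) (c j.succ : T)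
      ≤ ∑ c : Fin (ℓ + 1) ↪ T, ∏ j : Fin ℓ,
        pathMatrix ((k : ℝ) / n) p.1 (c j.castSucc) (c j.succ) := by
        refine Finset.sum_le_sum fun c _ => ?_
        have := Finset.prod_univ_sum (fun _ : Fin ℓ => (Finset.univ : Finset (Fin k)))
          (fun j i => arcWeight p (((c j.castSucc : T) : Fin n), i) (c j.succ : T))
        rw [Fintype.piFinset_univ] at this
        rw [← this]
        exact Finset.prod_le_prod (fun j _ => Finset.sum_nonneg fun i _ => hw _ _)
          fun j _ => sum_arcWeight_le p _ _
    _ ≤ ∑ c : Fin (ℓ + 1) → T, ∏ j : Fin ℓ,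
        pathMatrix ((k : ℝ) / n) p.1 (c j.castSucc) (c j.succ) := by
        rw [← Finset.sum_image (s := Finset.univ) (g := fun c : Fin (ℓ + 1) ↪ T => (c : _ → _))
          (f := fun c => ∏ j : Fin ℓ, pathMatrix ((k : ℝ) / n) p.1 (c j.castSucc) (c j.succ))
          DFunLike.coe_injective.injOn]
        exact Finset.sum_le_sum_of_subset_of_nonneg (Finset.subset_univ _)
          fun c _ _ => Finset.prod_nonneg fun j _ => hM _ _
    _ = _ := by simpa using sum_prod_eq_walkWeight (pathMatrix ((k : ℝ) / n) p.1) ℓ fun _ => 1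

theorem card_labeledPath : Fintype.card (LabeledPath k T ℓ) =
    T.card.descFactorial (ℓ + 1) * k ^ ℓ := by
  simp [LabeledPath, Fintype.card_embedding_eq]

theorem sum_num_present (hA : IndepOfArcs T A) (hn : 0 < n) :
    ∑ p : LabeledPath k T ℓ, num (fun f => A f ∧ p.Present f) =
      T.card.descFactorial (ℓ + 1) * ((k : ℝ) / n) ^ ℓ * num A := by
  have hn' : (0 : ℝ) < n := by exact_mod_cast hn
  have : ∀ p : LabeledPath k T ℓ, num (fun f => A f ∧ p.Present f) = num A / n ^ ℓ :=
    fun p => by rw [← num_and_present hA p]; field_simp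
  rw [Finset.sum_congr rfl fun p _ => this p, Finset.sum_const, Finset.card_univ,
    card_labeledPath, nsmul_eq_mul]
  push_cast
  rw [div_pow]
  ring

/-- First moment bound for paths in `T`. -/
theorem num_hasPathIn_le (hA : IndepOfArcs T A) (hn : 0 < n) :
    num (fun f => A f ∧ HasPathIn f T ℓ) ≤
      T.card * ((k : ℝ) * T.card / n) ^ ℓ * num A := by
  calc num (fun f => A f ∧ HasPathIn f T ℓ)
      ≤ num (fun f => ∃ p ∈ (Finset.univ : Finset (LabeledPath k T ℓ)), A f ∧ p.Present f) :=
        num_mono fun f hf => by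
          obtain ⟨p, hp⟩ := hasPathIn_iff.1 hf.2
          exact ⟨p, Finset.mem_univ _, hf.1, hp⟩
    _ ≤ _ := num_exists_le _ _
    _ = T.card.descFactorial (ℓ + 1) * ((k : ℝ) / n) ^ ℓ * num A := sum_num_present hA hn
    _ ≤ (T.card : ℝ) ^ (ℓ + 1) * ((k : ℝ) / n) ^ ℓ * num A := by
        have := num_nonneg A
        gcongr
        exact_mod_cast Nat.descFactorial_le_pow _ _
    _ = _ := by
        rw [pow_succ', mul_div_right_comm, mul_pow]
        ring

/-- Second moment bound for paths in `T`. -/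
theorem sum_num_present_le (hA : IndepOfArcs T A) (hn : 0 < n) (hT : k * T.card ≤ n)
    (hℓ : (ℓ : ℝ) * (ℓ * (1 + 2 * k * ℓ)) ≤ n) :
    ∑ p : LabeledPath k T ℓ, num (fun f => A f ∧ p.Present f) ≤
      num (fun f => A f ∧ HasPathIn f T ℓ) *
        (T.card * ((k : ℝ) * T.card / n) ^ ℓ + ℓ * (ℓ * (1 + 2 * k * ℓ))) := by
  have hn' : (0 : ℝ) < n := by exact_mod_cast hn
  set E := ∑ p : LabeledPath k T ℓ, num (fun f => A f ∧ p.Present f) with hE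
  set B := T.card * ((k : ℝ) * T.card / n) ^ ℓ + ℓ * (ℓ * (1 + 2 * k * ℓ)) with hB
  have hB0 : 0 ≤ B := by positivity
  have hE0 : 0 ≤ E := Finset.sum_nonneg fun p _ => num_nonneg _
  let X : (Fin n × Fin k → Fin n) → ℝ := fun f =>
    ∑ p : LabeledPath k T ℓ, if A f ∧ p.Present f then 1 else 0
  let Y : (Fin n × Fin k → Fin n) → ℝ := fun f => if A f ∧ HasPathIn f T ℓ then 1 else 0
  have hX : ∑ f, X f = E := by
    rw [Finset.sum_comm, hE]
    refine Finset.sum_congr rfl fun p _ => ?_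
    rw [num_eq_sum]
    congr!
  have hYX : ∀ f, Y f * X f = X f := by
    intro f
    simp only [X, Y]
    split_ifs with h
    · rw [one_mul]
    · rw [zero_mul, eq_comm]
      refine Finset.sum_eq_zero fun p _ => if_neg fun hp => h ⟨hp.1, hasPathIn_iff.2 ⟨p, hp.2⟩⟩
  have hY : ∑ f, Y f ^ 2 = num (fun f => A f ∧ HasPathIn f T ℓ) := by
    rw [num_eq_sum]
    refine Finset.sum_congr rfl fun f _ => ?_
    simp only [Y]
    split_ifs <;> norm_num
  have hwalk : ∀ p : LabeledPath k T ℓ,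
      ∑ q : LabeledPath k T ℓ, ∏ j, arcWeight p (q.key j) (q.target j) ≤ B := by
    intro p
    refine (sum_prod_arcWeight_le p).trans ?_
    have hcard : (T.card : ℝ) ≤ n := by
      exact_mod_cast (Finset.card_le_univ T).trans (by simp)
    have := (walkWeight_pathMatrix_le p.1.injective (a := (k : ℝ) / n) (n := n) (κ := k)
      (by positivity) (by positivity) (by field_simp) (by simpa using hcard)
      (by
        rw [Fintype.card_coe, div_mul_eq_mul_div, div_le_one hn']
        exact_mod_cast hT) hℓ ℓ le_rfl).1
    rwa [Fintype.card_coe, div_mul_eq_mul_div] at this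
  have hX2 : ∑ f, X f ^ 2 ≤ E * B := by
    calc ∑ f, X f ^ 2 = ∑ p : LabeledPath k T ℓ, ∑ q : LabeledPath k T ℓ,
          num (fun f => (A f ∧ p.Present f) ∧ q.Present f) := by
          simp only [num_eq_sum]
          rw [Finset.sum_congr rfl fun p _ => Finset.sum_comm, Finset.sum_comm]
          refine Finset.sum_congr rfl fun f _ => ?_
          rw [sq, Finset.sum_mul_sum]
          refine Finset.sum_congr rfl fun p _ => Finset.sum_congr rfl fun q _ => ?_
          by_cases h1 : A f <;> by_cases h2 : p.Present f <;> by_cases h3 : q.Present f <;>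
            simp [h1, h2, h3]
      _ ≤ ∑ p : LabeledPath k T ℓ, num (fun f => A f ∧ p.Present f) * B := by
          refine Finset.sum_le_sum fun p _ => ?_
          calc _ ≤ ∑ q : LabeledPath k T ℓ, num (fun f => A f ∧ p.Present f) *
                ∏ j, arcWeight p (q.key j) (q.target j) :=
                Finset.sum_le_sum fun q _ => num_present_present_le hA p q
            _ ≤ _ := by
              rw [← Finset.mul_sum]
              exact mul_le_mul_of_nonneg_left (hwalk p) (num_nonneg _)
      _ = E * B := by rw [← Finset.sum_mul]
  have hCS := Finset.sum_mul_sq_le_sq_mul_sq Finset.univ Y X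
  rw [Finset.sum_congr rfl fun f _ => hYX f, hX, hY] at hCS
  rcases hE0.eq_or_lt with h | h
  · rw [← h]
    exact mul_nonneg (num_nonneg _) hB0
  · have : E * E ≤ E * (num (fun f => A f ∧ HasPathIn f T ℓ) * B) := by
      calc E * E = E ^ 2 := (sq E).symm
        _ ≤ _ := hCS
        _ ≤ num (fun f => A f ∧ HasPathIn f T ℓ) * (E * B) :=
          mul_le_mul_of_nonneg_left hX2 (num_nonneg _)
        _ = _ := by ring
    exact le_of_mul_le_mul_left this h

end Paths

section ClosedSets

variable {n k : ℕ} {f : Fin n × Fin k → Fin n}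

theorem Reaches.mem_of_isClosedSet {S : Set (Fin n)} (hS : IsClosedSet f S) {u v : Fin n}
    (hu : u ∈ S) (h : Reaches f u v) : v ∈ S := by
  induction h with
  | refl => exact hu
  | tail _ hs ih =>
    obtain ⟨i, rfl⟩ := hs
    exact hS _ ih i

theorem indepOfArcs_isClosedSet_isStrConn (S : Finset (Fin n)) :
    IndepOfArcs (k := k) Sᶜ fun f => IsClosedSet f S ∧ IsStrConn f S := by
  rintro f f' hff ⟨hcl, hne, hconn⟩
  have heq : ∀ v ∈ S, ∀ i, f (v, i) = f' (v, i) := fun v hv i => hff v (by simpa using hv) i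
  refine ⟨fun v hv i => heq v hv i ▸ hcl v hv i, hne, fun u hu v hv => ?_⟩
  have key : ∀ w, Reaches f u w → Reaches f' u w := by
    intro w hw
    induction hw with
    | refl => exact Relation.ReflTransGen.refl
    | @tail b c hb hs ih =>
      obtain ⟨i, rfl⟩ := hs
      exact ih.tail ⟨i, (heq b (Reaches.mem_of_isClosedSet hcl hu hb) i).symm⟩
  exact key v (hconn u hu v hv)

theorem IsStrConn.subset_of_mem {S S' : Set (Fin n)} (hS : IsStrConn f S)
    (hS' : IsClosedSet f S') {x : Fin n} (hx : x ∈ S) (hx' : x ∈ S') : S ⊆ S' := fun y hy =>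
  Reaches.mem_of_isClosedSet hS' hx' (hS.2 x hx y hy)

theorem eq_of_isStrConn_of_lt_card {S S' : Finset (Fin n)}
    (hS : IsClosedSet f S ∧ IsStrConn f (S : Set (Fin n)))
    (hS' : IsClosedSet f S' ∧ IsStrConn f (S' : Set (Fin n)))
    (h : n < 2 * S.card) (h' : n < 2 * S'.card) : S = S' := by
  obtain ⟨x, hx⟩ : (S ∩ S').Nonempty := by
    rw [← Finset.card_pos]
    have h1 := Finset.card_union_add_card_inter S S'
    have h2 : (S ∪ S').card ≤ n := (Finset.card_le_univ _).trans (by simp)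
    omega
  rw [Finset.mem_inter] at hx
  exact Finset.Subset.antisymm
    (Finset.coe_subset.1 (hS.2.subset_of_mem hS'.1 hx.1 hx.2))
    (Finset.coe_subset.1 (hS'.2.subset_of_mem hS.1 hx.2 hx.1))

/-- Bounds conditional on the large closed strongly connected set are bounds for the
probability. -/
theorem num_exists_isStrConn_and_le (W : Finset (Finset (Fin n)))
    (hW : ∀ S ∈ W, n < 2 * S.card) (Q : (Fin n × Fin k → Fin n) → Set (Fin n) → Prop)
    {q : ℝ} (hq : 0 ≤ q)
    (h : ∀ S ∈ W, num (fun f => (IsClosedSet f S ∧ IsStrConn f S) ∧ Q f (S : Set (Fin n))) ≤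
      q * num (fun f : Fin n × Fin k → Fin n => IsClosedSet f S ∧ IsStrConn f S)) :
    num (fun f => ∃ S ∈ W, (IsClosedSet f S ∧ IsStrConn f S) ∧ Q f (S : Set (Fin n))) ≤
      q * Fintype.card (Fin n × Fin k → Fin n) := by
  refine (num_exists_le W _).trans ((Finset.sum_le_sum h).trans ?_)
  rw [← Finset.mul_sum]
  exact mul_le_mul_of_nonneg_left (sum_num_le_card W _ fun f S hS S' hS' h1 h2 =>
    eq_of_isStrConn_of_lt_card h1 h2 (hW S hS) (hW S' hS')) hq

theorem exists_arc_to (hk : 0 < k) {S : Set (Fin n)} (hS : IsClosedSet f S ∧ IsStrConn f S)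
    {v : Fin n} (hv : v ∈ S) : ∃ u ∈ S, ∃ i, f (u, i) = v := by
  have hw := hS.1 v hv ⟨0, hk⟩
  rcases Relation.ReflTransGen.cases_tail (hS.2.2 _ hw v hv) with h | ⟨b, hb, i, hi⟩
  · exact ⟨v, hv, ⟨0, hk⟩, h.symm⟩
  · exact ⟨b, Reaches.mem_of_isClosedSet hS.1 hw hb, i, hi⟩

theorem num_isStrConn_mul_le (hk : 0 < k) (S : Finset (Fin n)) :
    num (fun f : Fin n × Fin k → Fin n => IsClosedSet f S ∧ IsStrConn f S) *
        (n : ℝ) ^ (k * S.card) ≤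
      num (fun g : S × Fin k → S => Function.Surjective g) *
        Fintype.card (Fin n × Fin k → Fin n) := by
  let key : S × Fin k → Fin n × Fin k := fun x => (x.1, x.2)
  have hkey : Function.Injective key := by
    rintro ⟨u, i⟩ ⟨v, j⟩ h
    obtain ⟨h1, h2⟩ := Prod.ext_iff.1 h
    exact Prod.ext (Subtype.ext h1) h2
  have hcard : (Finset.univ : Finset (S × Fin k)).card = k * S.card := by
    simp [mul_comm]
  calc _ ≤ num (fun f : Fin n × Fin k → Fin n =>
        ∃ g ∈ Finset.univ.filter fun g : S × Fin k → S => Function.Surjective g,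
          ∀ x, f (key x) = g x) * (n : ℝ) ^ (k * S.card) := by
        refine mul_le_mul_of_nonneg_right (num_mono fun f hf => ?_) (by positivity)
        refine ⟨fun x => ⟨f (key x), hf.1 _ x.1.2 _⟩, ?_, fun x => rfl⟩
        simp only [Finset.mem_filter, Finset.mem_univ, true_and]
        rintro ⟨v, hv⟩
        obtain ⟨u, hu, i, hi⟩ := exists_arc_to hk hf hv
        exact ⟨(⟨u, hu⟩, i), Subtype.ext hi⟩
    _ ≤ (∑ g ∈ Finset.univ.filter fun g : S × Fin k → S => Function.Surjective g,
          num fun f : Fin n × Fin k → Fin n => ∀ x, f (key x) = g x) *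
            (n : ℝ) ^ (k * S.card) :=
        mul_le_mul_of_nonneg_right (num_exists_le _ _) (by positivity)
    _ = ∑ g ∈ Finset.univ.filter fun g : S × Fin k → S => Function.Surjective g,
          (Fintype.card (Fin n × Fin k → Fin n) : ℝ) := by
        rw [Finset.sum_mul]
        refine Finset.sum_congr rfl fun g _ => ?_
        have := num_and_prescribed key (fun x => (g x : Fin n)) Finset.univ hkey.injOn
          (fun _ => True) fun _ _ _ h => h
        rw [hcard, num_true] at this
        simpa using this
    _ = _ := by
        rw [Finset.sum_const, nsmul_eq_mul]
        unfold num
        congr!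

end ClosedSets

section Surjections

theorem num_le_of_injective {Ω Ω' : Type*} [Fintype Ω] [Fintype Ω'] {P : Ω → Prop}
    {Q : Ω' → Prop} (F : {x // P x} → {y // Q y}) (hF : Function.Injective F) :
    num P ≤ num Q := by
  unfold num
  rw [← Fintype.card_subtype, ← Fintype.card_subtype]
  exact_mod_cast Fintype.card_le_of_injective F hF

/-- The exponential generating function of the numbers of surjections onto `β` bounds each of
its terms. -/
theorem num_surjective_mul_pow_le {z : ℝ} (hz : 0 < z) (β : Type) [Fintype β] :
    ∀ (α : Type) [Fintype α], num (fun g : α → β => Function.Surjective g) *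
      z ^ Fintype.card α ≤ (Fintype.card α).factorial * (Real.exp z - 1) ^ Fintype.card β := by
  have hexp : 0 < Real.exp z - 1 := by linarith [Real.add_one_lt_exp hz.ne']
  refine Fintype.induction_empty_option (P := fun β _ => ∀ (α : Type) [Fintype α],
    num (fun g : α → β => Function.Surjective g) * z ^ Fintype.card α ≤
      (Fintype.card α).factorial * (Real.exp z - 1) ^ Fintype.card β) ?_ ?_ ?_ β
  · intro β γ _ e ih α _
    let _ := Fintype.ofEquiv γ e.symm
    rw [← Fintype.card_congr e]
    refine le_trans (mul_le_mul_of_nonneg_right ?_ (by positivity)) (ih α)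
    refine num_le_of_injective (fun g => ⟨fun x => e.symm (g.1 x),
      e.symm.surjective.comp g.2⟩) fun g g' h => Subtype.ext (funext fun x => ?_)
    exact e.symm.injective (congrFun (Subtype.ext_iff.1 h) x)
  · intro α _
    rcases isEmpty_or_nonempty α with h | h
    · have : num (fun g : α → PEmpty => Function.Surjective g) ≤ 1 := by
        unfold num
        norm_cast
        exact (Finset.card_le_univ _).trans (by simp)
      simpa using this
    · rw [num_eq_zero, zero_mul]
      · positivity
      · intro g
        exact (g h.some).elim
  · intro β _ ih α _
    set N := Fintype.card α with hN
    set c := (Real.exp z - 1) ^ Fintype.card β with hc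
    have hc0 : 0 ≤ c := by positivity
    let noneSet : (α → Option β) → Finset α := fun g => Finset.univ.filter fun x => g x = none
    have hfib : ∀ t : Finset α,
        num (fun g : α → Option β => Function.Surjective g ∧ noneSet g = t) ≤
          num (fun g : {x // x ∉ t} → β => Function.Surjective g) := by
      intro t
      have hsome : ∀ g : α → Option β, noneSet g = t → ∀ x, x ∉ t ↔ (g x).isSome = true := by
        rintro g rfl x
        simp [noneSet, Option.isSome_iff_ne_none]
      refine num_le_of_injective (fun g => ⟨fun x => (g.1 x).get ((hsome g.1 g.2.2 x).1 x.2),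
        fun b => ?_⟩) fun g g' h => Subtype.ext (funext fun x => ?_)
      · obtain ⟨x, hx⟩ := g.2.1 (some b)
        exact ⟨⟨x, (hsome g.1 g.2.2 x).2 (by simp [hx])⟩, by simp [hx]⟩
      · by_cases hx : x ∈ t
        · have h1 := (hsome g.1 g.2.2 x).not.1 (not_not.2 hx)
          have h2 := (hsome g'.1 g'.2.2 x).not.1 (not_not.2 hx)
          rw [Option.not_isSome_iff_eq_none] at h1 h2
          rw [h1, h2]
        · have := congrFun (Subtype.ext_iff.1 h) ⟨x, hx⟩
          exact Option.get_inj.1 this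
    have hterm : ∀ t : Finset α,
        num (fun g : {x // x ∉ t} → β => Function.Surjective g) * z ^ N ≤
          (N - t.card).factorial * z ^ t.card * c := by
      intro t
      have hcard : Fintype.card {x // x ∉ t} = N - t.card := by
        rw [Fintype.card_subtype_compl, Fintype.card_coe]
      have htN : t.card ≤ N := Finset.card_le_univ t
      have h := ih {x // x ∉ t}
      rw [hcard] at h
      have h' : num (fun g : {x // x ∉ t} → β => Function.Surjective g) * z ^ (N - t.card) ≤
          (N - t.card).factorial * c := by convert h
      calc _ = num (fun g : {x // x ∉ t} → β => Function.Surjective g) * z ^ (N - t.card) *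
            z ^ t.card := by rw [mul_assoc, ← pow_add, Nat.sub_add_cancel htN]
        _ ≤ ((N - t.card).factorial * c) * z ^ t.card :=
            mul_le_mul_of_nonneg_right h' (by positivity)
        _ = _ := by ring
    calc num (fun g : α → Option β => Function.Surjective g) * z ^ N
        ≤ num (fun g : α → Option β => ∃ t ∈ (Finset.univ : Finset α).powerset.erase ∅,
          Function.Surjective g ∧ noneSet g = t) * z ^ N := by
          refine mul_le_mul_of_nonneg_right (num_mono fun g hg => ?_) (by positivity)
          refine ⟨noneSet g, ?_, hg, rfl⟩
          obtain ⟨x, hx⟩ := hg none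
          have hmem : x ∈ noneSet g := by simpa [noneSet] using hx
          simp only [Finset.powerset_univ, Finset.mem_erase, Finset.mem_univ, and_true]
          exact Finset.ne_empty_of_mem hmem
      _ ≤ (∑ t ∈ (Finset.univ : Finset α).powerset.erase ∅,
          num fun g : α → Option β => Function.Surjective g ∧ noneSet g = t) * z ^ N :=
          mul_le_mul_of_nonneg_right (num_exists_le _ _) (by positivity)
      _ ≤ ∑ t ∈ (Finset.univ : Finset α).powerset.erase ∅,
          (N - t.card).factorial * z ^ t.card * c := by
          rw [Finset.sum_mul]
          refine Finset.sum_le_sum fun t _ => le_trans ?_ (hterm t)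
          exact mul_le_mul_of_nonneg_right (hfib t) (by positivity)
      _ = (∑ j ∈ Finset.range (N + 1), N.factorial * (z ^ j / j.factorial) - N.factorial) *
          c := by
          rw [← Finset.sum_mul, Finset.sum_erase_eq_sub (Finset.empty_mem_powerset _),
            Finset.sum_powerset_apply_card fun j => ((N - j).factorial : ℝ) * z ^ j]
          congr 2
          · rw [Finset.card_univ, ← hN]
            refine Finset.sum_congr rfl fun j hj => ?_
            have hj' : j ≤ N := Nat.lt_succ_iff.1 (Finset.mem_range.1 hj)
            have h1 : ((N.choose j * j.factorial * (N - j).factorial : ℕ) : ℝ) =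
              N.factorial := by rw [Nat.choose_mul_factorial_mul_factorial hj']
            have h2 : (j.factorial : ℝ) ≠ 0 := by exact_mod_cast j.factorial_ne_zero
            rw [← h1, nsmul_eq_mul]
            push_cast
            field_simp
          · simp
      _ ≤ (N.factorial * Real.exp z - N.factorial) * c := by
          rw [← Finset.mul_sum]
          gcongr
          exact Real.sum_le_exp_of_nonneg hz.le _
      _ = _ := by rw [Fintype.card_option, pow_succ]; ring

end Surjections

section Rate

theorem exp_neg_eq_of_tau {k : ℕ} {τ : ℝ} (hτ : 1 - τ / k - Real.exp (-τ) = 0) :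
    Real.exp (-τ) = 1 - τ / k := by linarith

theorem mul_exp_neg_lt_one {k : ℕ} (hk : 2 ≤ k) {τ : ℝ} (hτpos : 0 < τ)
    (hτ : 1 - τ / k - Real.exp (-τ) = 0) : k * Real.exp (-τ) < 1 := by
  have hk' : (0 : ℝ) < k := by positivity
  have h1 : k * Real.exp (-τ) = k - τ := by
    rw [exp_neg_eq_of_tau hτ]
    field_simp
  have h2 := Real.add_one_lt_exp hτpos.ne'
  have h3 : Real.exp (-τ) * Real.exp τ = 1 := by rw [← Real.exp_add]; simp
  have h4 := Real.exp_pos (-τ)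
  by_contra! h
  nlinarith

/-- The exponential rate, per vertex, of the expected number of closed sets of density `x` all of
whose vertices have an in-neighbour in the set. -/
noncomputable def rate (k : ℕ) (τ x : ℝ) : ℝ :=
  Real.negMulLog (1 - x) / x + (k - 1) * Real.log x +
    (Real.log (Real.exp τ - 1) - k * Real.log τ + k * Real.log k - k)

variable {k : ℕ} {τ : ℝ}

theorem rate_eq_zero (hk : 2 ≤ k) (hτpos : 0 < τ) (hτ : 1 - τ / k - Real.exp (-τ) = 0) :
    rate k τ (τ / k) = 0 := by
  have hk' : (0 : ℝ) < k := by positivity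
  have h1 := exp_neg_eq_of_tau hτ
  have h2 : Real.log (1 - τ / k) = -τ := by rw [← h1, Real.log_exp]
  have h3 : Real.exp τ - 1 = Real.exp τ * (τ / k) := by
    have : Real.exp τ * Real.exp (-τ) = 1 := by rw [← Real.exp_add]; simp
    have h : τ / k = 1 - Real.exp (-τ) := by linarith
    rw [h, mul_sub, this, mul_one]
  unfold rate
  rw [Real.negMulLog, h2, h3, Real.log_mul (Real.exp_pos _).ne' (by positivity), Real.log_exp,
    Real.log_div hτpos.ne' hk'.ne']
  field_simp
  ring

theorem mul_log_lt_log {y t : ℝ} (hy : 0 < y) (hy1 : y < 1) (ht : 0 < t) (ht1 : t < 1) :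
    t * Real.log y < Real.log (t * y + (1 - t)) := by
  have := strictConcaveOn_log_Ioi.2 (Set.mem_Ioi.2 hy) (Set.mem_Ioi.2 one_pos) hy1.ne ht
    (sub_pos.2 ht1) (by ring)
  simpa using this

theorem log_one_sub_add_pos (hk : 2 ≤ k) (hτpos : 0 < τ) (hτ : 1 - τ / k - Real.exp (-τ) = 0)
    {x : ℝ} (hx : 0 < x) (hxν : x < τ / k) : 0 < Real.log (1 - x) + k * x := by
  have hk' : (0 : ℝ) < k := by positivity
  have h1 := exp_neg_eq_of_tau hτ
  have hpos := Real.exp_pos (-τ)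
  have h2 : Real.log (1 - τ / k) = -τ := by rw [← h1, Real.log_exp]
  have hν : 0 < τ / k := by positivity
  have ht : x / (τ / k) < 1 := (div_lt_one hν).2 hxν
  have := mul_log_lt_log (y := 1 - τ / k) (t := x / (τ / k)) (by linarith) (by linarith)
    (by positivity) ht
  rw [h2] at this
  have e1 : x / (τ / k) * (1 - τ / k) + (1 - x / (τ / k)) = 1 - x := by
    field_simp
    ring
  have e2 : x / (τ / k) * -τ = -(k * x) := by
    field_simp
  rw [e1, e2] at this
  linarith

theorem log_one_sub_add_neg (hk : 2 ≤ k) (hτpos : 0 < τ) (hτ : 1 - τ / k - Real.exp (-τ) = 0)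
    {x : ℝ} (hxν : τ / k < x) (hx : x < 1) : Real.log (1 - x) + k * x < 0 := by
  have hk' : (0 : ℝ) < k := by positivity
  have h1 := exp_neg_eq_of_tau hτ
  have h2 : Real.log (1 - τ / k) = -τ := by rw [← h1, Real.log_exp]
  have hν : 0 < τ / k := by positivity
  have hx0 : 0 < x := hν.trans hxν
  have ht : (τ / k) / x < 1 := (div_lt_one hx0).2 hxν
  have := mul_log_lt_log (y := 1 - x) (t := (τ / k) / x) (by linarith) (by linarith)
    (by positivity) ht
  have e1 : (τ / k) / x * (1 - x) + (1 - (τ / k) / x) = 1 - τ / k := by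
    field_simp
    ring
  have e2 : -τ = (τ / k) / x * (-(k * x)) := by field_simp
  rw [e1, h2, e2] at this
  have := lt_of_mul_lt_mul_left this (by positivity)
  linarith

theorem hasDerivAt_rate {x : ℝ} (hx : 0 < x) (hx1 : x < 1) :
    HasDerivAt (rate k τ) ((Real.log (1 - x) + k * x) / x ^ 2) x := by
  have h1 : HasDerivAt (fun x : ℝ => 1 - x) (-1) x := by
    simpa using (hasDerivAt_id x).const_sub 1
  have h2 := (Real.hasDerivAt_negMulLog (by linarith : (1 - x) ≠ 0)).comp x h1
  have h3 := (h2.div (hasDerivAt_id x) hx.ne').add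
    ((Real.hasDerivAt_log hx.ne').const_mul ((k : ℝ) - 1))
  have h4 := h3.add_const (Real.log (Real.exp τ - 1) - k * Real.log τ + k * Real.log k - k)
  refine h4.congr_deriv ?_
  simp only [Function.comp, id, Real.negMulLog]
  field_simp
  ring

theorem continuousOn_rate : ContinuousOn (rate k τ) (Set.Ioi 0) := by
  unfold rate
  refine ContinuousOn.add (ContinuousOn.add ?_ ?_) continuousOn_const
  · exact ((Real.continuous_negMulLog.comp (continuous_const.sub continuous_id)).continuousOn).div
      continuousOn_id fun x hx => (Set.mem_Ioi.1 hx).ne'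
  · exact continuousOn_const.mul (Real.continuousOn_log.mono fun x hx => (Set.mem_Ioi.1 hx).ne')

theorem strictMonoOn_rate (hk : 2 ≤ k) (hτpos : 0 < τ) (hτ : 1 - τ / k - Real.exp (-τ) = 0) :
    StrictMonoOn (rate k τ) (Set.Ioc 0 (τ / k)) := by
  have hlt : τ / k < 1 := by linarith [Real.exp_pos (-τ)]
  refine strictMonoOn_of_deriv_pos (convex_Ioc _ _)
    (continuousOn_rate.mono fun x hx => hx.1) fun x hx => ?_
  rw [interior_Ioc] at hx
  rw [(hasDerivAt_rate hx.1 (hx.2.trans hlt)).deriv]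
  exact div_pos (log_one_sub_add_pos hk hτpos hτ hx.1 hx.2) (pow_pos hx.1 2)

theorem strictAntiOn_rate (hk : 2 ≤ k) (hτpos : 0 < τ) (hτ : 1 - τ / k - Real.exp (-τ) = 0) :
    StrictAntiOn (rate k τ) (Set.Icc (τ / k) 1) := by
  have hν : 0 < τ / k := by positivity
  refine strictAntiOn_of_deriv_neg (convex_Icc _ _)
    (continuousOn_rate.mono fun x hx => hν.trans_le hx.1) fun x hx => ?_
  rw [interior_Icc] at hx
  have hx0 : 0 < x := hν.trans hx.1
  rw [(hasDerivAt_rate hx0 hx.2).deriv]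
  exact div_neg_of_neg_of_pos (log_one_sub_add_neg hk hτpos hτ hx.1 hx.2) (pow_pos hx0 2)

theorem exists_rate_le (hk : 2 ≤ k) (hτpos : 0 < τ) (hτ : 1 - τ / k - Real.exp (-τ) = 0)
    {δ : ℝ} (hδ : 0 < δ) :
    ∃ η > 0, ∀ x, 0 < x → x ≤ 1 → δ < |x - τ / k| → rate k τ x ≤ -η := by
  have hν : 0 < τ / k := by positivity
  have hlt : τ / k < 1 := by linarith [Real.exp_pos (-τ)]
  have h0 := rate_eq_zero hk hτpos hτ
  have hmono := strictMonoOn_rate hk hτpos hτ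
  have hanti := strictAntiOn_rate hk hτpos hτ
  set y := max (τ / k - δ) (τ / k / 2) with hy
  set y' := min (τ / k + δ) 1 with hy'
  have hy0 : 0 < y := lt_max_of_lt_right (by positivity)
  have hyν : y < τ / k := max_lt (by linarith) (by linarith)
  have hy'ν : τ / k < y' := lt_min (by linarith) hlt
  have hy'1 : y' ≤ 1 := min_le_right _ _
  have h1 := hmono ⟨hy0, hyν.le⟩ ⟨hν, le_rfl⟩ hyν
  have h2 := hanti ⟨le_rfl, hlt.le⟩ ⟨hy'ν.le, hy'1⟩ hy'ν
  rw [h0] at h1 h2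
  refine ⟨min (-rate k τ y) (-rate k τ y'), lt_min (by linarith) (by linarith), ?_⟩
  intro x hx hx1 hxδ
  rcases lt_abs.1 hxδ with h | h
  · have : y' ≤ x := (min_le_left _ _).trans (by linarith)
    have := hanti.antitoneOn ⟨hy'ν.le, hy'1⟩ ⟨by linarith, hx1⟩ this
    linarith [min_le_right (-rate k τ y) (-rate k τ y')]
  · have : x ≤ y := (by linarith : x ≤ τ / k - δ).trans (le_max_left _ _)
    have := hmono.monotoneOn ⟨hx, by linarith⟩ ⟨hy0, hyν.le⟩ this
    linarith [min_le_left (-rate k τ y) (-rate k τ y')]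

theorem log_factorial_le {m : ℕ} (hm : 1 ≤ m) :
    Real.log m.factorial ≤ 1 + Real.log m + m * Real.log m - m := by
  induction m, hm using Nat.le_induction with
  | base => simp
  | succ m hm ih =>
    have hm' : (0 : ℝ) < m := by exact_mod_cast hm
    have h1 := Real.log_le_sub_one_of_pos (x := (m : ℝ) / (m + 1)) (by positivity)
    rw [Real.log_div hm'.ne' (by positivity)] at h1
    have h2 : (m : ℝ) / (m + 1) - 1 = -1 / (m + 1) := by field_simp; ring
    rw [h2, le_div_iff₀ (by positivity)] at h1
    rw [Nat.factorial_succ]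
    push_cast
    rw [Real.log_mul (by positivity) (by positivity)]
    linarith

theorem log_choose_le {n s : ℕ} (hs : s ≤ n) :
    Real.log (n.choose s) ≤ n * Real.log n - s * Real.log s - (n - s : ℕ) * Real.log (n - s : ℕ) := by
  have h : (s ^ s * (n - s) ^ (n - s)) * n.choose s ≤ n ^ n := by
    have := add_pow s (n - s) n
    rw [Nat.add_sub_cancel' hs] at this
    rw [this]
    exact Finset.single_le_sum (f := fun m => s ^ m * (n - s) ^ (n - m) * n.choose m)
      (fun _ _ => Nat.zero_le _) (Finset.mem_range.2 (by omega))
  have hpos : ∀ a : ℕ, (0 : ℝ) < (a : ℝ) ^ a := fun a => by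
    rcases Nat.eq_zero_or_pos a with rfl | ha
    · simp
    · positivity
  have hc : (0 : ℝ) < n.choose s := by exact_mod_cast Nat.choose_pos hs
  have h' : ((s : ℝ) ^ s * ((n - s : ℕ) : ℝ) ^ (n - s)) * n.choose s ≤ (n : ℝ) ^ n := by
    exact_mod_cast h
  have h2 := Real.log_le_log (mul_pos (mul_pos (hpos s) (hpos (n - s))) hc) h'
  rw [Real.log_mul (mul_pos (hpos s) (hpos (n - s))).ne' hc.ne',
    Real.log_mul (hpos s).ne' (hpos (n - s)).ne', Real.log_pow, Real.log_pow, Real.log_pow] at h2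
  linarith

theorem choose_mul_le_exp_rate (hk : 2 ≤ k) (hτpos : 0 < τ) {n s : ℕ} (hs : 1 ≤ s)
    (hsn : s ≤ n) :
    n.choose s * ((k * s).factorial * (Real.exp τ - 1) ^ s / τ ^ (k * s) / n ^ (k * s)) ≤
      Real.exp 1 * (k * s) * Real.exp (s * rate k τ (s / n)) := by
  have hexp : 0 < Real.exp τ - 1 := by linarith [Real.add_one_lt_exp hτpos.ne']
  have hs' : (0 : ℝ) < s := by exact_mod_cast hs
  have hn' : (0 : ℝ) < n := by exact_mod_cast hs.trans hsn
  have hk' : (0 : ℝ) < k := by positivity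
  have hc : (0 : ℝ) < n.choose s := by exact_mod_cast Nat.choose_pos hsn
  have hf : (0 : ℝ) < (k * s).factorial := by positivity
  rw [← Real.log_le_log_iff (by positivity) (by positivity),
    Real.log_mul hc.ne' (by positivity), Real.log_div (by positivity) (by positivity),
    Real.log_div (by positivity) (by positivity), Real.log_mul hf.ne' (by positivity),
    Real.log_mul (by positivity) (by positivity), Real.log_mul (by positivity) (by positivity),
    Real.log_exp, Real.log_exp, Real.log_pow, Real.log_pow, Real.log_pow]
  have h1 := log_choose_le hsn
  have h2 := log_factorial_le (m := k * s) (Nat.mul_pos (by omega) hs)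
  push_cast at h2 ⊢
  have h3 : (s : ℝ) * rate k τ (s / n) = -((n - s : ℕ) * Real.log (n - s : ℕ)) +
      (n - s) * Real.log n + (k - 1) * s * (Real.log s - Real.log n) +
      s * (Real.log (Real.exp τ - 1) - k * Real.log τ + k * Real.log k - k) := by
    have h4 : n * Real.negMulLog (1 - s / n) =
        -((n - s : ℕ) * Real.log (n - s : ℕ)) + (n - s) * Real.log n := by
      rw [Nat.cast_sub hsn]
      rcases hsn.eq_or_lt with h | h
      · subst h
        simp [hs'.ne']
      · have h5 : (0 : ℝ) < n - s := by
          have : (s : ℝ) < n := by exact_mod_cast h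
          linarith
        have h6 : (1 : ℝ) - s / n = (n - s) / n := by field_simp
        rw [h6, Real.negMulLog, Real.log_div h5.ne' hn'.ne']
        field_simp
        ring
    rw [rate, Real.log_div hs'.ne' hn'.ne', ← h4]
    field_simp
  have h7 : Real.log ((k : ℝ) * s) = Real.log k + Real.log s :=
    Real.log_mul hk'.ne' hs'.ne'
  rw [h3]
  rw [h7] at h2 ⊢
  linarith

end Rate

section Density

variable {k : ℕ} {τ : ℝ}

/-- A bound for the probability that a given set of `s` vertices is closed and strongly
connected. -/
noncomputable def closedBound (k : ℕ) (τ : ℝ) (n s : ℕ) : ℝ :=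
  min ((s : ℝ) ^ (k * s)) ((k * s).factorial * (Real.exp τ - 1) ^ s / τ ^ (k * s)) /
    (n : ℝ) ^ (k * s)

theorem num_isStrConn_le (hk : 2 ≤ k) (hτpos : 0 < τ) {n : ℕ} (hn : 0 < n)
    (S : Finset (Fin n)) :
    num (fun f : Fin n × Fin k → Fin n => IsClosedSet f S ∧ IsStrConn f S) ≤
      closedBound k τ n S.card * Fintype.card (Fin n × Fin k → Fin n) := by
  have hn' : (0 : ℝ) < n := by exact_mod_cast hn
  have hcard : Fintype.card (S × Fin k) = k * S.card := by simp [mul_comm]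
  have h1 : num (fun g : S × Fin k → S => Function.Surjective g) ≤
      (S.card : ℝ) ^ (k * S.card) := by
    refine (num_mono (Q := fun _ => True) fun _ _ => trivial).trans ?_
    rw [num_true, Fintype.card_fun, hcard, Fintype.card_coe]
    push_cast
    rfl
  have h2 : num (fun g : S × Fin k → S => Function.Surjective g) ≤
      (k * S.card).factorial * (Real.exp τ - 1) ^ S.card / τ ^ (k * S.card) := by
    have := num_surjective_mul_pow_le hτpos S (S × Fin k)
    rw [hcard, Fintype.card_coe] at this
    refine (le_div_iff₀ (by positivity)).2 (le_trans (le_of_eq ?_) this)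
    congr!
  have h3 := num_isStrConn_mul_le (by omega : 0 < k) S
  rw [closedBound, div_mul_eq_mul_div, le_div_iff₀ (by positivity)]
  exact h3.trans (mul_le_mul_of_nonneg_right (le_min h1 h2) (Nat.cast_nonneg _))

theorem closedBound_nonneg (hτpos : 0 < τ) (n s : ℕ) : 0 ≤ closedBound k τ n s := by
  have hexp : 0 < Real.exp τ - 1 := by linarith [Real.add_one_lt_exp hτpos.ne']
  unfold closedBound
  positivity

/-- The expected number of closed strongly connected sets of size `s`, if `s / n` is far from
`τ / k`, is at most this number. -/
noncomputable def atypicalBound (k : ℕ) (τ δ : ℝ) (n s : ℕ) : ℝ :=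
  if 1 ≤ s ∧ s ≤ n ∧ δ < |(s : ℝ) / n - τ / k| then n.choose s * closedBound k τ n s else 0

theorem tendsto_atypicalBound (hk : 2 ≤ k) (hτpos : 0 < τ) (δ : ℝ) (s : ℕ) :
    Tendsto (fun n => atypicalBound k τ δ n s) atTop (nhds 0) := by
  have hlim : Tendsto (fun n : ℕ => (s : ℝ) ^ (k * s) / n) atTop (nhds 0) :=
    tendsto_const_div_atTop_nhds_zero_nat _
  have h0 : ∀ n, 0 ≤ atypicalBound k τ δ n s := fun n => by
    unfold atypicalBound
    split_ifs
    · exact mul_nonneg (Nat.cast_nonneg _) (closedBound_nonneg hτpos _ _)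
    · exact le_rfl
  refine squeeze_zero' (Eventually.of_forall h0) ?_ hlim
  filter_upwards [eventually_ge_atTop 1] with n hn
  have hn' : (1 : ℝ) ≤ n := by exact_mod_cast hn
  unfold atypicalBound
  split_ifs with h
  · obtain ⟨hs, hsn, -⟩ := h
    calc (n.choose s : ℝ) * closedBound k τ n s
        ≤ (n : ℝ) ^ s * ((s : ℝ) ^ (k * s) / (n : ℝ) ^ (k * s)) := by
          refine mul_le_mul (by exact_mod_cast Nat.choose_le_pow n s) ?_
            (closedBound_nonneg hτpos _ _) (by positivity)
          unfold closedBound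
          gcongr
          exact min_le_left _ _
      _ ≤ (s : ℝ) ^ (k * s) / n := by
          rw [mul_div_assoc', div_le_div_iff₀ (by positivity) (by positivity)]
          have : (n : ℝ) ^ (s + 1) ≤ (n : ℝ) ^ (k * s) := pow_le_pow_right₀ hn' (by nlinarith)
          calc _ = (s : ℝ) ^ (k * s) * (n : ℝ) ^ (s + 1) := by ring
            _ ≤ _ := by gcongr
  · positivity

theorem exists_atypicalBound_le (hk : 2 ≤ k) (hτpos : 0 < τ)
    (hτ : 1 - τ / k - Real.exp (-τ) = 0) {δ : ℝ} (hδ : 0 < δ) :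
    ∃ b : ℕ → ℝ, Summable b ∧ ∀ n s, ‖atypicalBound k τ δ n s‖ ≤ b s := by
  obtain ⟨η, hη, hrate⟩ := exists_rate_le hk hτpos hτ hδ
  refine ⟨fun s => Real.exp 1 * k * ((s : ℝ) ^ 1 * Real.exp (-η) ^ s), ?_, fun n s => ?_⟩
  · refine Summable.mul_left _ (summable_pow_mul_geometric_of_norm_lt_one 1 ?_)
    rw [Real.norm_eq_abs, abs_of_pos (Real.exp_pos _), Real.exp_lt_one_iff]
    linarith
  · unfold atypicalBound
    split_ifs with h
    · obtain ⟨hs, hsn, hsδ⟩ := h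
      have hn' : (0 : ℝ) < n := by exact_mod_cast hs.trans hsn
      have hs' : (0 : ℝ) < s := by exact_mod_cast hs
      have hsn' : (s : ℝ) ≤ n := by exact_mod_cast hsn
      have h1 := hrate (s / n) (by positivity) ((div_le_one hn').2 hsn') hsδ
      rw [Real.norm_of_nonneg (mul_nonneg (Nat.cast_nonneg _) (closedBound_nonneg hτpos _ _))]
      calc (n.choose s : ℝ) * closedBound k τ n s
          ≤ n.choose s *
            ((k * s).factorial * (Real.exp τ - 1) ^ s / τ ^ (k * s) / n ^ (k * s)) := by
            unfold closedBound
            gcongr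
            exact min_le_right _ _
        _ ≤ Real.exp 1 * (k * s) * Real.exp (s * rate k τ (s / n)) :=
            choose_mul_le_exp_rate hk hτpos hs hsn
        _ ≤ Real.exp 1 * (k * s) * Real.exp (s * -η) := by gcongr
        _ = _ := by rw [Real.exp_nat_mul]; ring
    · rw [norm_zero]
      positivity

/-- Closed strongly connected sets have density close to `τ / k`. -/
theorem tendsto_num_atypical (hk : 2 ≤ k) (hτpos : 0 < τ)
    (hτ : 1 - τ / k - Real.exp (-τ) = 0) {δ : ℝ} (hδ : 0 < δ) :
    Tendsto (fun n : ℕ => num (fun f : Fin n × Fin k → Fin n =>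
      ∃ S ∈ Finset.univ.filter fun S : Finset (Fin n) => δ < |(S.card : ℝ) / n - τ / k|,
        IsClosedSet f S ∧ IsStrConn f (S : Set (Fin n))) /
          Fintype.card (Fin n × Fin k → Fin n)) atTop (nhds 0) := by
  obtain ⟨b, hb, hbound⟩ := exists_atypicalBound_le hk hτpos hτ hδ
  have hlim := tendsto_tsum_of_dominated_convergence hb
    (fun s => tendsto_atypicalBound hk hτpos δ s) (Eventually.of_forall hbound)
  rw [tsum_zero] at hlim
  refine squeeze_zero' (Eventually.of_forall fun n => div_nonneg (num_nonneg _)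
    (Nat.cast_nonneg _)) ?_ hlim
  filter_upwards [eventually_ge_atTop 1] with n hn
  have : Nonempty (Fin n) := ⟨⟨0, hn⟩⟩
  rw [div_le_iff₀ (by exact_mod_cast Fintype.card_pos)]
  have hterm : ∀ S : Finset (Fin n), δ < |(S.card : ℝ) / n - τ / k| →
      num (fun f : Fin n × Fin k → Fin n => IsClosedSet f S ∧ IsStrConn f S) ≤
        (if 1 ≤ S.card ∧ S.card ≤ n ∧ δ < |(S.card : ℝ) / n - τ / k| then
          closedBound k τ n S.card else 0) * Fintype.card (Fin n × Fin k → Fin n) := by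
    intro S hS
    rcases S.eq_empty_or_nonempty with rfl | hne
    · rw [num_eq_zero]
      · simp
      · rintro f ⟨-, h, -⟩
        simp at h
    · rw [if_pos ⟨Finset.card_pos.2 hne, (Finset.card_le_univ S).trans (by simp), hS⟩]
      exact num_isStrConn_le hk hτpos hn S
  calc _ ≤ ∑ S ∈ Finset.univ.filter fun S : Finset (Fin n) => δ < |(S.card : ℝ) / n - τ / k|,
        num (fun f : Fin n × Fin k → Fin n => IsClosedSet f S ∧ IsStrConn f S) :=
        num_exists_le _ _
    _ ≤ ∑ S ∈ Finset.univ.filter fun S : Finset (Fin n) => δ < |(S.card : ℝ) / n - τ / k|,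
        (if 1 ≤ S.card ∧ S.card ≤ n ∧ δ < |(S.card : ℝ) / n - τ / k| then
          closedBound k τ n S.card else 0) * Fintype.card (Fin n × Fin k → Fin n) :=
        Finset.sum_le_sum fun S hS => hterm S (Finset.mem_filter.1 hS).2
    _ ≤ ∑ S ∈ (Finset.univ : Finset (Fin n)).powerset,
        (if 1 ≤ S.card ∧ S.card ≤ n ∧ δ < |(S.card : ℝ) / n - τ / k| then
          closedBound k τ n S.card else 0) * Fintype.card (Fin n × Fin k → Fin n) := by
        refine Finset.sum_le_sum_of_subset_of_nonneg (by simp) fun S _ _ => ?_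
        have := closedBound_nonneg (k := k) hτpos n S.card
        split_ifs <;> positivity
    _ = (∑ s ∈ Finset.range (n + 1), atypicalBound k τ δ n s) *
        Fintype.card (Fin n × Fin k → Fin n) := by
        rw [← Finset.sum_mul, Finset.sum_powerset_apply_card fun s : ℕ =>
          if 1 ≤ s ∧ s ≤ n ∧ δ < |(s : ℝ) / n - τ / k| then closedBound k τ n s else 0]
        congr 1
        rw [Finset.card_univ, Fintype.card_fin]
        refine Finset.sum_congr rfl fun s _ => ?_
        rw [atypicalBound, nsmul_eq_mul, mul_ite, mul_zero]
    _ = _ := by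
        rw [tsum_eq_sum]
        intro s hs
        rw [atypicalBound, if_neg]
        rintro ⟨-, h, -⟩
        exact hs (Finset.mem_range.2 (by omega))

end Density

section LongestPath

variable {n k ℓ : ℕ}

theorem HasPathIn.of_le {f : Fin n × Fin k → Fin n} {A : Set (Fin n)} (h : HasPathIn f A ℓ)
    {m : ℕ} (hm : m ≤ ℓ) : HasPathIn f A m := by
  obtain ⟨c, hc, hA, hf⟩ := h
  exact ⟨fun j => c (Fin.castLE (by omega) j), fun i j hij => by simpa using hc hij,
    fun j => hA _, fun j => hf (Fin.castLE hm j)⟩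

theorem bddAbove_hasPathIn (f : Fin n × Fin k → Fin n) (A : Set (Fin n)) :
    BddAbove {ℓ | HasPathIn f A ℓ} := by
  refine ⟨n, fun ℓ ⟨c, hc, _⟩ => ?_⟩
  have := Fintype.card_le_of_injective c hc
  simp only [Fintype.card_fin] at this
  omega

theorem hasPathIn_ceil_of_lt_sSup {f : Fin n × Fin k → Fin n} {A : Set (Fin n)} {x : ℝ}
    (hx : 0 ≤ x) (h : x < (sSup {ℓ | HasPathIn f A ℓ} : ℕ)) : HasPathIn f A ⌈x⌉₊ := by
  have hne : {ℓ | HasPathIn f A ℓ}.Nonempty := by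
    by_contra hne
    rw [Set.not_nonempty_iff_eq_empty.1 hne] at h
    simp at h
    linarith
  exact HasPathIn.of_le (Nat.sSup_mem hne (bddAbove_hasPathIn f A)) (Nat.ceil_le.2 h.le)

theorem not_hasPathIn_ceil_of_sSup_lt {f : Fin n × Fin k → Fin n} {A : Set (Fin n)} {x : ℝ}
    (h : (sSup {ℓ | HasPathIn f A ℓ} : ℕ) < x) : ¬ HasPathIn f A ⌈x⌉₊ := fun hp =>
  absurd (Nat.ceil_le.1 (le_csSup (bddAbove_hasPathIn f A) hp)) h.not_ge

theorem pow_mul_one_sub_le_descFactorial {m : ℕ} (hm : 0 < m) (ℓ : ℕ) :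
    (m : ℝ) ^ (ℓ + 1) * (1 - ℓ * (ℓ + 1) / m) ≤ m.descFactorial (ℓ + 1) := by
  have hm' : (0 : ℝ) < m := by exact_mod_cast hm
  rcases le_or_gt ℓ m with h | h
  · have hℓ : (ℓ : ℝ) / m ≤ 1 := (div_le_one hm').2 (by exact_mod_cast h)
    have h1 := one_add_mul_le_pow (a := -((ℓ : ℝ) / m)) (by linarith) (ℓ + 1)
    have h2 : ((m - ℓ : ℕ) : ℝ) ^ (ℓ + 1) ≤ m.descFactorial (ℓ + 1) := by
      have := Nat.pow_sub_le_descFactorial m (ℓ + 1)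
      rw [Nat.add_sub_add_right] at this
      exact_mod_cast this
    calc (m : ℝ) ^ (ℓ + 1) * (1 - ℓ * (ℓ + 1) / m)
        = (m : ℝ) ^ (ℓ + 1) * (1 + (ℓ + 1 : ℕ) * -((ℓ : ℝ) / m)) := by push_cast; ring
      _ ≤ (m : ℝ) ^ (ℓ + 1) * (1 + -((ℓ : ℝ) / m)) ^ (ℓ + 1) := by gcongr
      _ = ((m - ℓ : ℕ) : ℝ) ^ (ℓ + 1) := by
        rw [← mul_pow, Nat.cast_sub h]
        congr 1
        field_simp
        ring
      _ ≤ _ := h2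
  · refine le_trans (mul_nonpos_of_nonneg_of_nonpos (by positivity) ?_) (Nat.cast_nonneg _)
    rw [sub_nonpos, le_div_iff₀ hm']
    have : (m : ℝ) ≤ ℓ := by exact_mod_cast h.le
    nlinarith

theorem num_not_hasPathIn_le {T : Finset (Fin n)} {A : (Fin n × Fin k → Fin n) → Prop}
    (hA : IndepOfArcs T A) (hk : 0 < k) (hn : 0 < n) (hT0 : 0 < T.card) (hT : k * T.card ≤ n)
    (hℓ : (ℓ : ℝ) * (ℓ * (1 + 2 * k * ℓ)) ≤ n) :
    num (fun f => A f ∧ ¬ HasPathIn f T ℓ) ≤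
      (ℓ * (ℓ + 1) / T.card +
        ℓ * (ℓ * (1 + 2 * k * ℓ)) / (T.card * ((k : ℝ) * T.card / n) ^ ℓ)) * num A := by
  have h1 := sum_num_present_le hA hn hT hℓ
  rw [sum_num_present hA hn] at h1
  have h2 := num_and_add_num_and_not A fun f => HasPathIn f T ℓ
  have h3 := pow_mul_one_sub_le_descFactorial hT0 ℓ
  have h4 := num_nonneg fun f => A f ∧ ¬ HasPathIn f (T : Set (Fin n)) ℓ
  have h5 := num_nonneg A
  set m := (T.card : ℝ)
  set c : ℝ := ℓ * (ℓ * (1 + 2 * k * ℓ)) with hc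
  have hm : 0 < m := by simpa [m] using hT0
  have hn' : (0 : ℝ) < n := by exact_mod_cast hn
  have hk' : (0 : ℝ) < k := by exact_mod_cast hk
  set a := m * (k * m / n) ^ ℓ with ha
  have ha0 : 0 < a := by positivity
  have hc0 : 0 ≤ c := by positivity
  set P := num fun f => A f ∧ HasPathIn f (T : Set (Fin n)) ℓ
  have h6 : a * (1 - ℓ * (ℓ + 1) / m) ≤ T.card.descFactorial (ℓ + 1) * ((k : ℝ) / n) ^ ℓ := by
    calc a * (1 - ℓ * (ℓ + 1) / m)
        = m ^ (ℓ + 1) * (1 - ℓ * (ℓ + 1) / m) * ((k : ℝ) / n) ^ ℓ := by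
          rw [ha, mul_div_right_comm, mul_pow]
          ring
      _ ≤ _ := by gcongr
  have h7 := (mul_le_mul_of_nonneg_right h6 h5).trans h1
  have h8 : P * c ≤ num A * c := by gcongr; linarith
  refine le_of_mul_le_mul_left ?_ ha0
  have h9 : a * ((ℓ * (ℓ + 1) / m + c / a) * num A) =
      a * (ℓ * (ℓ + 1) / m) * num A + c * num A := by
    field_simp
  rw [h9]
  nlinarith

theorem tendsto_mul_pow_ceil {b ρ : ℝ} (hρ0 : 0 < ρ) (hρ1 : ρ < 1)
    (h : 1 < b * -Real.log ρ) :
    Tendsto (fun n : ℕ => (n : ℝ) * ρ ^ ⌈b * Real.log n⌉₊) atTop (nhds 0) := by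
  have hlim : Tendsto (fun n : ℕ => (n : ℝ) ^ (-(b * -Real.log ρ - 1))) atTop (nhds 0) :=
    (tendsto_rpow_neg_atTop (by linarith)).comp tendsto_natCast_atTop_atTop
  refine squeeze_zero' (Eventually.of_forall fun n => by positivity) ?_ hlim
  filter_upwards [eventually_gt_atTop 0] with n hn
  have hn' : (0 : ℝ) < n := by exact_mod_cast hn
  calc (n : ℝ) * ρ ^ ⌈b * Real.log n⌉₊ ≤ n * ρ ^ (b * Real.log n) := by
        rw [← Real.rpow_natCast]
        exact mul_le_mul_of_nonneg_left
          (Real.rpow_le_rpow_of_exponent_ge hρ0 hρ1.le (Nat.le_ceil _)) hn'.le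
    _ = (n : ℝ) ^ (-(b * -Real.log ρ - 1)) := by
        rw [Real.rpow_def_of_pos hρ0, Real.rpow_def_of_pos hn']
        nth_rewrite 1 [← Real.exp_log hn']
        rw [← Real.exp_add]
        ring_nf

theorem tendsto_pow_div_mul_pow_ceil {b ρ : ℝ} (hb : 0 ≤ b) (hρ0 : 0 < ρ) (hρ1 : ρ < 1)
    (h : b * -Real.log ρ < 1) (p : ℕ) :
    Tendsto (fun n : ℕ => ((⌈b * Real.log n⌉₊ : ℝ) + 1) ^ p / (n * ρ ^ ⌈b * Real.log n⌉₊))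
      atTop (nhds 0) := by
  set s := 1 - b * -Real.log ρ with hs
  have hs0 : 0 < s := by linarith
  have hlim : Tendsto (fun n : ℕ => (b / s + 2) ^ p / ρ *
      (Real.log ((n : ℝ) ^ s) ^ p / (n : ℝ) ^ s)) atTop (nhds 0) := by
    rw [← mul_zero ((b / s + 2) ^ p / ρ)]
    exact ((Real.isLittleO_pow_log_id_atTop.tendsto_div_nhds_zero).comp
      ((tendsto_rpow_atTop hs0).comp tendsto_natCast_atTop_atTop)).const_mul _
  refine squeeze_zero' (Eventually.of_forall fun n => by positivity) ?_ hlim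
  have hlog : ∀ᶠ n : ℕ in atTop, 1 ≤ s * Real.log n :=
    ((Real.tendsto_log_atTop.comp tendsto_natCast_atTop_atTop).const_mul_atTop
      hs0).eventually_ge_atTop 1
  filter_upwards [eventually_gt_atTop 0, hlog] with n hn hn1
  have hn' : (0 : ℝ) < n := by exact_mod_cast hn
  have hlog0 : 0 ≤ Real.log n := Real.log_natCast_nonneg n
  have hceil := Nat.ceil_lt_add_one (mul_nonneg hb hlog0)
  rw [Real.log_rpow hn', div_mul_div_comm, ← mul_pow]
  have h1 : (⌈b * Real.log n⌉₊ : ℝ) + 1 ≤ (b / s + 2) * (s * Real.log n) := by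
    have : (b / s + 2) * (s * Real.log n) = b * Real.log n + 2 * (s * Real.log n) := by
      field_simp
    linarith
  have h2 : ρ * (n : ℝ) ^ s ≤ n * ρ ^ ⌈b * Real.log n⌉₊ := by
    calc ρ * (n : ℝ) ^ s = n * ρ ^ (b * Real.log n + 1) := by
          rw [Real.rpow_def_of_pos hρ0, Real.rpow_def_of_pos hn']
          nth_rewrite 1 [← Real.exp_log hρ0]
          nth_rewrite 2 [← Real.exp_log hn']
          rw [← Real.exp_add, ← Real.exp_add, hs]
          ring_nf
      _ ≤ n * ρ ^ ⌈b * Real.log n⌉₊ := by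
          rw [← Real.rpow_natCast]
          exact mul_le_mul_of_nonneg_left
            (Real.rpow_le_rpow_of_exponent_ge hρ0 hρ1.le hceil.le) hn'.le
  gcongr

theorem tendsto_ceil_pow_div {b : ℝ} (hb : 0 ≤ b) (p : ℕ) :
    Tendsto (fun n : ℕ => ((⌈b * Real.log n⌉₊ : ℝ) + 1) ^ p / n) atTop (nhds 0) := by
  have : Tendsto (fun ρ : ℝ => b * -Real.log ρ) (nhds 1) (nhds 0) := by
    have := ((Real.continuousAt_log one_ne_zero).neg.const_mul b).tendsto
    simpa using this
  have hev : ∀ᶠ ρ : ℝ in nhdsWithin 1 (Set.Iio 1), 0 < ρ ∧ ρ < 1 ∧ b * -Real.log ρ < 1 := by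
    filter_upwards [self_mem_nhdsWithin, nhdsWithin_le_nhds (lt_mem_nhds one_pos),
      nhdsWithin_le_nhds (this.eventually_lt_const one_pos)] with ρ h1 h2 h3
    exact ⟨h2, h1, h3⟩
  obtain ⟨ρ, h0, h1, h2⟩ := hev.exists
  refine squeeze_zero' (Eventually.of_forall fun n => by positivity) ?_
    (tendsto_pow_div_mul_pow_ceil hb h0 h1 h2 p)
  filter_upwards [eventually_gt_atTop 0] with n hn
  have hn' : (0 : ℝ) < n := by exact_mod_cast hn
  exact div_le_div_of_nonneg_left (by positivity) (by positivity)
    (mul_le_of_le_one_right hn'.le (pow_le_one₀ h0.le h1.le))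

end LongestPath

section Giant

variable {k : ℕ} {τ : ℝ}

theorem exists_density_window (hk : 2 ≤ k) (hτpos : 0 < τ) (hτ : 1 - τ / k - Real.exp (-τ) = 0)
    {b₁ b₂ : ℝ} (hb₁ : 1 / Real.log (Real.exp τ / k) < b₁)
    (hb₂ : b₂ < 1 / Real.log (Real.exp τ / k)) :
    ∃ δ > 0, 1 / 2 < τ / k - δ ∧ 0 < 1 - τ / k - δ ∧ k * (1 - τ / k + δ) < 1 ∧
      1 < b₁ * -Real.log (k * (1 - τ / k + δ)) ∧ b₂ * -Real.log (k * (1 - τ / k - δ)) < 1 := by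
  have hk' : (2 : ℝ) ≤ k := by exact_mod_cast hk
  have hk0 : (0 : ℝ) < k := by linarith
  have h1 := mul_exp_neg_lt_one hk hτpos hτ
  have h2 := exp_neg_eq_of_tau hτ
  have hlog : Real.log (Real.exp τ / k) = -Real.log (k * (1 - τ / k)) := by
    rw [← h2, Real.log_mul hk0.ne' (Real.exp_pos _).ne', Real.log_div (Real.exp_pos _).ne' hk0.ne',
      Real.log_exp, Real.log_exp]
    ring
  have hpos : 0 < k * (1 - τ / k) := by rw [← h2]; positivity
  have hlog0 : 0 < -Real.log (k * (1 - τ / k)) := by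
    rw [neg_pos]
    exact Real.log_neg hpos (h2 ▸ h1)
  rw [hlog, div_lt_iff₀ hlog0] at hb₁
  rw [hlog, lt_div_iff₀ hlog0] at hb₂
  have hhalf : 1 / 2 < τ / k := by
    have : 1 - τ / k < 1 / 2 := by
      rw [← h2, lt_div_iff₀ two_pos]
      nlinarith [Real.exp_pos (-τ)]
    linarith
  have hadd : ContinuousAt (fun δ : ℝ => k * (1 - τ / k + δ)) 0 := by fun_prop
  have hsub : ContinuousAt (fun δ : ℝ => k * (1 - τ / k - δ)) 0 := by fun_prop
  have hladd : ContinuousAt (fun δ : ℝ => b₁ * -Real.log (k * (1 - τ / k + δ))) 0 :=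
    (hadd.log (by simpa using hpos.ne')).neg.const_mul b₁
  have hlsub : ContinuousAt (fun δ : ℝ => b₂ * -Real.log (k * (1 - τ / k - δ))) 0 :=
    (hsub.log (by simpa using hpos.ne')).neg.const_mul b₂
  have hev : ∀ᶠ δ : ℝ in nhds 0, δ < τ / k - 1 / 2 ∧ δ < 1 - τ / k ∧
      k * (1 - τ / k + δ) < 1 ∧ 1 < b₁ * -Real.log (k * (1 - τ / k + δ)) ∧
      b₂ * -Real.log (k * (1 - τ / k - δ)) < 1 := by
    filter_upwards [gt_mem_nhds (show (0 : ℝ) < τ / k - 1 / 2 by linarith),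
      gt_mem_nhds (show (0 : ℝ) < 1 - τ / k by rw [← h2]; positivity),
      hadd.eventually_lt_const (u := 1) (by simpa using h2 ▸ h1),
      hladd.eventually_const_lt (u := 1) (by simpa using hb₁),
      hlsub.eventually_lt_const (u := 1) (by simpa using hb₂)] with δ h₁ h₂ h₃ h₄ h₅
    exact ⟨h₁, h₂, h₃, h₄, h₅⟩
  obtain ⟨δ, ⟨h₁, h₂, h₃, h₄, h₅⟩, hδ⟩ :=
    ((hev.filter_mono nhdsWithin_le_nhds).and
      (self_mem_nhdsWithin : ∀ᶠ δ : ℝ in nhdsWithin 0 (Set.Ioi 0), δ ∈ Set.Ioi 0)).exists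
  exact ⟨δ, hδ, by linarith, by linarith, h₃, h₄, h₅⟩

/-- The sets whose density is close to `τ / k`. -/
noncomputable def typicalSets (k : ℕ) (τ δ : ℝ) (n : ℕ) : Finset (Finset (Fin n)) :=
  Finset.univ.filter fun S => |(S.card : ℝ) / n - τ / k| ≤ δ

theorem card_compl_of_mem_typicalSets {δ : ℝ} {n : ℕ} (hn : 0 < n) {S : Finset (Fin n)}
    (hS : S ∈ typicalSets k τ δ n) :
    (1 - τ / k - δ) * n ≤ (Sᶜ.card : ℝ) ∧ (Sᶜ.card : ℝ) ≤ (1 - τ / k + δ) * n := by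
  have hn' : (0 : ℝ) < n := by exact_mod_cast hn
  have h := abs_le.1 (Finset.mem_filter.1 hS).2
  rw [neg_le_sub_iff_le_add, ← sub_le_iff_le_add, le_div_iff₀ hn', sub_le_iff_le_add,
    div_le_iff₀ hn'] at h
  have hc : (Sᶜ.card : ℝ) = n - S.card := by
    rw [Finset.card_compl, Fintype.card_fin, Nat.cast_sub (by simpa using Finset.card_le_univ S)]
  rw [hc]
  constructor <;> linarith [h.1, h.2]

theorem lt_two_mul_card_of_mem_typicalSets {δ : ℝ} (hδ : 1 / 2 < τ / k - δ) {n : ℕ} (hn : 0 < n)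
    {S : Finset (Fin n)} (hS : S ∈ typicalSets k τ δ n) : n < 2 * S.card := by
  have hn' : (0 : ℝ) < n := by exact_mod_cast hn
  have h := abs_le.1 (Finset.mem_filter.1 hS).2
  rw [← @Nat.cast_lt ℝ]
  have : 1 / 2 < (S.card : ℝ) / n := by linarith [h.1]
  rw [lt_div_iff₀ hn'] at this
  push_cast
  linarith

theorem tendsto_num_long_path {δ b : ℝ} (hk : 0 < k) (hδ : 0 < δ) (h1 : 1 / 2 < τ / k - δ)
    (h2 : 0 < 1 - τ / k - δ) (h3 : k * (1 - τ / k + δ) < 1)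
    (h4 : 1 < b * -Real.log (k * (1 - τ / k + δ))) :
    Tendsto (fun n : ℕ => num (fun f : Fin n × Fin k → Fin n => ∃ S ∈ typicalSets k τ δ n,
      (IsClosedSet f S ∧ IsStrConn f (S : Set (Fin n))) ∧
        HasPathIn f (S : Set (Fin n))ᶜ ⌈b * Real.log n⌉₊) /
          Fintype.card (Fin n × Fin k → Fin n)) atTop (nhds 0) := by
  have hk' : (0 : ℝ) < k := by exact_mod_cast hk
  refine squeeze_zero' (Eventually.of_forall fun n => div_nonneg (num_nonneg _)
    (Nat.cast_nonneg _)) ?_ (tendsto_mul_pow_ceil (mul_pos hk' (by linarith)) h3 h4)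
  filter_upwards [eventually_gt_atTop 0] with n hn
  have hn' : (0 : ℝ) < n := by exact_mod_cast hn
  have : Nonempty (Fin n) := ⟨⟨0, hn⟩⟩
  rw [div_le_iff₀ (by exact_mod_cast Fintype.card_pos)]
  have hpos : 0 < 1 - τ / k + δ := by linarith
  refine num_exists_isStrConn_and_le (typicalSets k τ δ n)
    (fun S => lt_two_mul_card_of_mem_typicalSets h1 hn)
    (fun f S => HasPathIn f Sᶜ ⌈b * Real.log n⌉₊) (by positivity) fun S hS => ?_
  have h := num_hasPathIn_le (ℓ := ⌈b * Real.log n⌉₊)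
    (indepOfArcs_isClosedSet_isStrConn (k := k) S) hn
  rw [Finset.coe_compl] at h
  refine h.trans (mul_le_mul_of_nonneg_right ?_ (num_nonneg _))
  have hS' := (card_compl_of_mem_typicalSets hn hS).2
  gcongr
  · exact (Finset.card_le_univ _).trans (by simp)
  · rw [div_le_iff₀ hn']
    nlinarith

theorem tendsto_num_no_path {δ b : ℝ} (hk : 0 < k) (hδ : 0 < δ) (h1 : 1 / 2 < τ / k - δ)
    (h2 : 0 < 1 - τ / k - δ) (h3 : k * (1 - τ / k + δ) < 1) (hb : 0 ≤ b)
    (h4 : b * -Real.log (k * (1 - τ / k - δ)) < 1) :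
    Tendsto (fun n : ℕ => num (fun f : Fin n × Fin k → Fin n => ∃ S ∈ typicalSets k τ δ n,
      (IsClosedSet f S ∧ IsStrConn f (S : Set (Fin n))) ∧
        ¬ HasPathIn f (S : Set (Fin n))ᶜ ⌈b * Real.log n⌉₊) /
          Fintype.card (Fin n × Fin k → Fin n)) atTop (nhds 0) := by
  have hk' : (0 : ℝ) < k := by exact_mod_cast hk
  set σ := 1 - τ / k - δ with hσ
  have hρ0 : 0 < k * σ := by positivity
  have hρ1 : k * σ < 1 := by nlinarith
  have hlim := ((tendsto_ceil_pow_div hb 2).const_mul (1 / σ)).add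
    ((tendsto_pow_div_mul_pow_ceil hb hρ0 hρ1 h4 3).const_mul ((1 + 2 * k) / σ))
  rw [mul_zero, mul_zero, add_zero] at hlim
  refine squeeze_zero' (Eventually.of_forall fun n => div_nonneg (num_nonneg _)
    (Nat.cast_nonneg _)) ?_ hlim
  filter_upwards [eventually_gt_atTop 0, (tendsto_ceil_pow_div hb 3).eventually_lt_const
    (show 0 < 1 / (1 + 2 * (k : ℝ)) by positivity)] with n hn hsmall
  have hn' : (0 : ℝ) < n := by exact_mod_cast hn
  have : Nonempty (Fin n) := ⟨⟨0, hn⟩⟩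
  rw [div_le_iff₀ (by exact_mod_cast Fintype.card_pos)]
  set ℓ := ⌈b * Real.log n⌉₊
  have hcube : (ℓ : ℝ) * (ℓ * (1 + 2 * k * ℓ)) ≤ (1 + 2 * k) * ((ℓ : ℝ) + 1) ^ 3 := by
    have hℓ : (0 : ℝ) ≤ ℓ := Nat.cast_nonneg ℓ
    calc (ℓ : ℝ) * (ℓ * (1 + 2 * k * ℓ))
        ≤ (ℓ + 1) * ((ℓ + 1) * (1 * (ℓ + 1) + 2 * k * (ℓ + 1))) := by gcongr <;> linarith
      _ = _ := by ring
  have hℓn : (ℓ : ℝ) * (ℓ * (1 + 2 * k * ℓ)) ≤ n := by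
    rw [div_lt_div_iff₀ hn' (by positivity)] at hsmall
    linarith
  refine num_exists_isStrConn_and_le (typicalSets k τ δ n)
    (fun S => lt_two_mul_card_of_mem_typicalSets h1 hn)
    (fun f S => ¬ HasPathIn f Sᶜ ℓ) (by positivity) fun S hS => ?_
  obtain ⟨hS1, hS2⟩ := card_compl_of_mem_typicalSets hn hS
  rw [← hσ] at hS1
  have hT0 : 0 < Sᶜ.card := by
    rw [← @Nat.cast_pos ℝ]
    exact lt_of_lt_of_le (by positivity) hS1
  have hT : k * Sᶜ.card ≤ n := by
    rw [← @Nat.cast_le ℝ]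
    push_cast
    nlinarith
  have h := num_not_hasPathIn_le (indepOfArcs_isClosedSet_isStrConn (k := k) S) hk hn hT0 hT hℓn
  rw [Finset.coe_compl] at h
  refine h.trans (mul_le_mul_of_nonneg_right (add_le_add ?_ ?_) (num_nonneg _))
  · calc (ℓ : ℝ) * (ℓ + 1) / Sᶜ.card ≤ (ℓ + 1) ^ 2 / (σ * n) := by
          gcongr
          nlinarith
      _ = _ := by rw [div_mul_div_comm, one_mul]
  · calc (ℓ : ℝ) * (ℓ * (1 + 2 * k * ℓ)) / (Sᶜ.card * ((k : ℝ) * Sᶜ.card / n) ^ ℓ)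
        ≤ (1 + 2 * k) * ((ℓ : ℝ) + 1) ^ 3 / (σ * n * (k * σ) ^ ℓ) := by
          gcongr
          rw [le_div_iff₀ hn', mul_assoc]
          gcongr
      _ = _ := by rw [div_mul_div_comm, mul_assoc σ]

theorem prob_le_of_imp {n : ℕ} {P A B C : (Fin n × Fin k → Fin n) → Prop}
    (h : ∀ f, P f → A f ∨ B f ∨ C f) :
    prob n k P ≤ num A / Fintype.card (Fin n × Fin k → Fin n) +
      (num B / Fintype.card (Fin n × Fin k → Fin n) +
        num C / Fintype.card (Fin n × Fin k → Fin n)) := by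
  rw [← add_div, ← add_div]
  have : num P ≤ num A + (num B + num C) :=
    (num_mono h).trans ((num_or_le _ _).trans (by gcongr; exact num_or_le _ _))
  exact div_le_div_of_nonneg_right this (Nat.cast_nonneg _)

end Giant

/-- The length `M_n` of the longest directed path outside the giant satisfies
`M_n / log n → 1/log(e^{τ_k}/k)` in probability. -/
theorem longest_path_outside_giant (k : ℕ) (hk : 2 ≤ k) (τ : ℝ) (hτpos : 0 < τ)
    (hτ : 1 - τ / k - Real.exp (-τ) = 0) (ε : ℝ) (hε : 0 < ε) :
    Filter.Tendsto (fun n : ℕ =>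
      prob n k (fun f => ∃ G : Set (Fin n), IsGiant f G ∧
        ε < |((sSup {ℓ : ℕ | HasPathIn f Gᶜ ℓ} : ℕ) : ℝ) / Real.log n -
              1 / Real.log (Real.exp τ / k)|))
      Filter.atTop (nhds 0) := by
  set c := 1 / Real.log (Real.exp τ / k) with hc
  have hcpos : 0 < c := by
    have hk0 : (0 : ℝ) < k := by positivity
    refine one_div_pos.2 (Real.log_pos ((one_lt_div hk0).2 ?_))
    have := mul_exp_neg_lt_one hk hτpos hτ
    rwa [Real.exp_neg, ← div_eq_mul_inv, div_lt_one (Real.exp_pos _)] at this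
  obtain ⟨δ, hδ, h1, h2, h3, h4, h5⟩ := exists_density_window hk hτpos hτ (b₁ := c + ε)
    (b₂ := max (c - ε) 0) (by linarith) (max_lt (by linarith) hcpos)
  have hk0 : 0 < k := by omega
  have hlim := (tendsto_num_atypical hk hτpos hτ hδ).add
    ((tendsto_num_long_path hk0 hδ h1 h2 h3 h4).add
      (tendsto_num_no_path hk0 hδ h1 h2 h3 (le_max_right _ _) h5))
  rw [add_zero, add_zero] at hlim
  refine squeeze_zero' (Eventually.of_forall fun n => by unfold prob; positivity) ?_ hlim
  filter_upwards [eventually_gt_atTop 1] with n hn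
  refine prob_le_of_imp ?_
  rintro f ⟨G, ⟨hclosed, hconn, -⟩, hdev⟩
  have hlog : 0 < Real.log n := Real.log_pos (by exact_mod_cast hn)
  have hG : (G.toFinset : Set (Fin n)) = G := Set.coe_toFinset G
  by_cases hdens : δ < |(G.toFinset.card : ℝ) / n - τ / k|
  · exact Or.inl ⟨G.toFinset, by simpa using hdens, by rwa [hG], by rwa [hG]⟩
  have hmem : G.toFinset ∈ typicalSets k τ δ n :=
    Finset.mem_filter.2 ⟨Finset.mem_univ _, not_lt.1 hdens⟩
  refine Or.inr ((lt_abs.1 hdev).imp (fun h => ?_) fun h => ?_)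
  · refine ⟨G.toFinset, hmem, ⟨by rwa [hG], by rwa [hG]⟩, ?_⟩
    rw [hG]
    refine hasPathIn_ceil_of_lt_sSup (by positivity) ((lt_div_iff₀ hlog).1 ?_)
    linarith
  · refine ⟨G.toFinset, hmem, ⟨by rwa [hG], by rwa [hG]⟩, ?_⟩
    rw [hG]
    refine not_hasPathIn_ceil_of_sSup_lt ((div_lt_iff₀ hlog).1 (lt_max_of_lt_left ?_))
    linarith
end
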